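/- arXiv:1412.4732 — 2 statements merged into one kernel-verified Lean document; each statement's English description precedes it below -/
import Mathlib

section
/- Let d ≥ 1, 1 < p < ∞, δ₁, δ₂ ∈ ℝ, and let k, ℓ, m be integers with 0 ≤ k ≤ ℓ ≤ m and (m+ℓ−k)p > d. Then there exists a constant C = C(d,m,ℓ,k,p,δ₁,δ₂) such that for all f, g ∈ C_c^∞(ℝ^d), Σ_{|α|≤k} ‖⟨x⟩^{δ₁+δ₂} D^α(fg)‖_{L^p(ℝ^d)} ≤ C · (Σ_{|α|≤m} ‖⟨x⟩^{δ₁} D^α f‖_{L^p(ℝ^d)}) · (Σ_{|β|≤ℓ} ‖⟨x⟩^{δ₂} D^β g‖_{L^p(ℝ^d)}). In other words, pointwise multiplication is bounded H^{m,p}_{δ₁}(ℝ^d) × H^{ℓ,p}_{δ₂}(ℝ^d) → H^{k,p}_{δ₁+δ₂}(ℝ^d). -/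
open MeasureTheory Filter
open scoped BigOperators ENNReal Topology

noncomputable section

/-- The Japanese bracket `⟨x⟩ = (1+|x|²)^{1/2}`. -/
def jb {d : ℕ} (x : EuclideanSpace ℝ (Fin d)) : ℝ := Real.sqrt (1 + ‖x‖ ^ 2)

/-- The partial derivative in the `i`-th coordinate direction. -/
def pd {d : ℕ} {F : Type*} [NormedAddCommGroup F] [NormedSpace ℝ F] (i : Fin d)
    (f : EuclideanSpace ℝ (Fin d) → F) : EuclideanSpace ℝ (Fin d) → F :=
  fun x => fderiv ℝ f x (EuclideanSpace.single i 1)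

/-- Iterated partial derivatives along a list of coordinate directions. -/
def pdList {d : ℕ} {F : Type*} [NormedAddCommGroup F] [NormedSpace ℝ F] :
    List (Fin d) → (EuclideanSpace ℝ (Fin d) → F) → EuclideanSpace ℝ (Fin d) → F
  | [], f => f
  | i :: l, f => pd i (pdList l f)

/-- The partial derivative `D^α f` corresponding to a multi-index `α : Fin d → ℕ`. -/
def mD {d : ℕ} {F : Type*} [NormedAddCommGroup F] [NormedSpace ℝ F] (α : Fin d → ℕ)
    (f : EuclideanSpace ℝ (Fin d) → F) : EuclideanSpace ℝ (Fin d) → F :=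
  pdList ((List.finRange d).flatMap fun i => List.replicate (α i) i) f

/-- The order `|α|` of a multi-index. -/
def msize {d : ℕ} (α : Fin d → ℕ) : ℕ := ∑ i, α i

/-- The finset of all multi-indices on `ℝ^d` of order at most `m`. -/
def mIdx (d m : ℕ) : Finset (Fin d → ℕ) :=
  (Fintype.piFinset fun _ : Fin d => Finset.range (m + 1)).filter fun α => msize α ≤ m

open scoped NNReal

theorem lintegral_rpow_le_measure_univ_mul {α : Type*} [MeasurableSpace α] (ν : Measure α)
    {p : ℝ} (hp : 1 < p) {h : α → ℝ≥0∞} (hh : Measurable h) :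
    (∫⁻ a, h a ∂ν) ^ p ≤ ν Set.univ ^ (p - 1) * ∫⁻ a, h a ^ p ∂ν := by
  have hpq := Real.HolderConjugate.conjExponent hp
  have hp0 : 0 < p := by linarith
  have key := ENNReal.lintegral_mul_le_Lp_mul_Lq ν hpq hh.aemeasurable
    (aemeasurable_const (b := (1 : ℝ≥0∞)))
  simp only [Pi.mul_apply, mul_one, ENNReal.one_rpow, lintegral_const, one_mul] at key
  calc (∫⁻ a, h a ∂ν) ^ p ≤ ((∫⁻ a, h a ^ p ∂ν) ^ (1 / p) *
        ν Set.univ ^ (1 / p.conjExponent)) ^ p := by gcongr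
    _ = _ := by
      rw [ENNReal.mul_rpow_of_nonneg _ _ hp0.le, ← ENNReal.rpow_mul, ← ENNReal.rpow_mul, mul_comm]
      congr 2
      · rw [Real.conjExponent]; field_simp
      · rw [one_div_mul_cancel hp0.ne', ENNReal.rpow_one]

theorem lintegral_rpow_le_weighted {α : Type*} [MeasurableSpace α] (ν : Measure α)
    {q q' : ℝ} (hq : q.HolderConjugate q') {h w : α → ℝ≥0∞} (hh : Measurable h)
    (hw : Measurable w) (hw0 : ∀ᵐ a ∂ν, w a ≠ 0) (hw' : ∀ᵐ a ∂ν, w a ≠ ⊤) :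
    (∫⁻ a, h a ∂ν) ^ q ≤ (∫⁻ a, (w a)⁻¹ ^ q' ∂ν) ^ (q / q') * ∫⁻ a, w a ^ q * h a ^ q ∂ν := by
  have key := ENNReal.lintegral_mul_le_Lp_mul_Lq ν hq (hw.mul hh).aemeasurable
    hw.inv.aemeasurable
  have hq0 : 0 < q := hq.pos
  have e : ∫⁻ a, ((w * h) * w⁻¹) a ∂ν = ∫⁻ a, h a ∂ν := by
    apply lintegral_congr_ae
    filter_upwards [hw0, hw'] with a h0 h1
    simp only [Pi.mul_apply, Pi.inv_apply]
    rw [mul_comm, ← mul_assoc, ENNReal.inv_mul_cancel h0 h1, one_mul]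
  rw [e] at key
  calc (∫⁻ a, h a ∂ν) ^ q ≤ ((∫⁻ a, (w * h) a ^ q ∂ν) ^ (1 / q) *
        (∫⁻ a, w⁻¹ a ^ q' ∂ν) ^ (1 / q')) ^ q := by gcongr
    _ = _ := by
      rw [ENNReal.mul_rpow_of_nonneg _ _ hq0.le, ← ENNReal.rpow_mul, ← ENNReal.rpow_mul, mul_comm,
        one_div_mul_cancel hq0.ne', ENNReal.rpow_one, one_div_mul_eq_div]
      simp only [Pi.mul_apply, Pi.inv_apply, ENNReal.mul_rpow_of_nonneg _ _ hq0.le]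

theorem lintegral_Ioo_rpow_ne_top {s : ℝ} (hs : -1 < s) :
    ∫⁻ r in Set.Ioo (0 : ℝ) 1, ENNReal.ofReal r ^ s ≠ ⊤ := by
  have h := (intervalIntegral.integrableOn_Ioo_rpow_iff (s := s) (zero_lt_one' ℝ)).2 hs
  have h2 := h.lintegral_lt_top.ne
  convert h2 using 1
  apply setLIntegral_congr_fun measurableSet_Ioo
  intro r hr
  exact ENNReal.ofReal_rpow_of_pos hr.1

theorem setLIntegral_comp_add_smul_rpow_le {E : Type*} [NormedAddCommGroup E] [NormedSpace ℝ E]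
    [MeasurableSpace E] [BorelSpace E] (μ : Measure E) (s : Set E) {p : ℝ} (hp : 1 < p)
    {G : E → ℝ≥0∞} (hG : Measurable G) (x : E) (r : ℝ) :
    (∫⁻ z in s, G (x + r • z) ∂μ) ^ p ≤ μ s ^ (p - 1) * ∫⁻ z in s, G (x + r • z) ^ p ∂μ := by
  have := lintegral_rpow_le_measure_univ_mul (μ.restrict s) hp
    (h := fun z => G (x + r • z)) (hG.comp (by fun_prop))
  rwa [Measure.restrict_apply_univ] at this

theorem enorm_le_lintegral_segment {E : Type*} [NormedAddCommGroup E] [NormedSpace ℝ E] {u : E → ℝ} (hu : ContDiff ℝ 1 u) (x z : E)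
    (hz : ‖z‖ ≤ 1) :
    ‖u x‖ₑ ≤ ∫⁻ r in Set.Ioo (0 : ℝ) 1, (‖u (x + r • z)‖ₑ + ‖fderiv ℝ u (x + r • z)‖ₑ) := by
  have hder (r : ℝ) : HasDerivAt (fun r : ℝ => (1 - r) * u (x + r • z))
      ((-1) * u (x + r • z) + (1 - r) * fderiv ℝ u (x + r • z) z) r := by
    have h1 : HasDerivAt (fun r : ℝ => x + r • z) z r := by
      simpa using ((hasDerivAt_id r).smul_const z).const_add x
    have h2 := ((hu.differentiable one_ne_zero) (x + r • z)).hasFDerivAt.comp_hasDerivAt r h1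
    exact ((hasDerivAt_id r).const_sub 1).mul h2
  have hc : ContDiff ℝ 1 (fun r : ℝ => (1 - r) * u (x + r • z)) := by fun_prop
  have h := enorm_sub_le_lintegral_deriv_of_contDiffOn_Icc (a := 0) (b := 1) hc.contDiffOn zero_le_one
  simp only [sub_self, zero_mul, sub_zero, zero_smul, add_zero, one_mul, zero_sub, enorm_neg] at h
  rw [← restrict_Ioo_eq_restrict_Icc] at h
  refine h.trans (setLIntegral_mono' measurableSet_Ioo fun r hr => ?_)
  rw [(hder r).deriv]
  refine (enorm_add_le _ _).trans (add_le_add ?_ ?_)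
  · simp
  · rw [← ofReal_norm, ← ofReal_norm]
    apply ENNReal.ofReal_le_ofReal
    rw [norm_mul, Real.norm_eq_abs, abs_of_nonneg (by linarith [hr.2])]
    calc (1 - r) * ‖fderiv ℝ u (x + r • z) z‖ ≤ 1 * (‖fderiv ℝ u (x + r • z)‖ * 1) := by
          gcongr
          · linarith [hr.1]
          · exact (ContinuousLinearMap.le_opNorm _ _).trans (by gcongr)
      _ = _ := by ring

section Ball

variable {E : Type*} [NormedAddCommGroup E] [NormedSpace ℝ E] [FiniteDimensional ℝ E]
  [MeasurableSpace E] [BorelSpace E] (μ : Measure E) [μ.IsAddHaarMeasure]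

theorem setLIntegral_comp_add_smul_le (s : Set E) {F : E → ℝ≥0∞} (hF : Measurable F) (x : E) {r : ℝ}
    (hr : 0 < r) :
    ∫⁻ z in s, F (x + r • z) ∂μ ≤
      ENNReal.ofReal r ^ (-(Module.finrank ℝ E : ℝ)) * ∫⁻ z, F z ∂μ := by
  calc ∫⁻ z in s, F (x + r • z) ∂μ ≤ ∫⁻ z, F (x + r • z) ∂μ := setLIntegral_le_lintegral _ _
    _ = ∫⁻ z, F (x + z) ∂(μ.map (r • ·)) := by
      rw [lintegral_map (f := fun z => F (x + z)) (hF.comp (measurable_const_add x))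
        (measurable_const_smul r)]
    _ = _ := by
      rw [Measure.map_addHaar_smul μ hr.ne', lintegral_smul_measure, lintegral_add_left_eq_self,
        smul_eq_mul]
      congr 1
      rw [abs_of_pos (by positivity), ENNReal.ofReal_rpow_of_pos hr, Real.rpow_neg hr.le,
        Real.rpow_natCast]

theorem lintegral_setLIntegral_comp_add_smul (s : Set E) {F : E → ℝ≥0∞} (hF : Measurable F)
    (r : ℝ) :
    ∫⁻ x, ∫⁻ z in s, F (x + r • z) ∂μ ∂μ = μ s * ∫⁻ z, F z ∂μ := by
  rw [lintegral_lintegral_swap]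
  · simp_rw [lintegral_add_right_eq_self]
    rw [lintegral_const, Measure.restrict_apply_univ, mul_comm]
  · exact (hF.comp (by fun_prop : Measurable fun a : E × E => a.1 + r • a.2)).aemeasurable

/-- The integral of `G` along the segments issued from `x`, in all directions of the unit ball. -/
def segAvg (G : E → ℝ≥0∞) (x : E) : ℝ≥0∞ :=
  ∫⁻ r in Set.Ioo (0 : ℝ) 1, ∫⁻ z in Metric.ball (0 : E) 1, G (x + r • z) ∂μ

theorem measurable_setLIntegral_comp_add_smul (s : Set E) {G : E → ℝ≥0∞} (hG : Measurable G) :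
    Measurable fun y : E × ℝ => ∫⁻ z in s, G (y.1 + y.2 • z) ∂μ :=
  Measurable.lintegral_prod_right'
    (f := fun a : (E × ℝ) × E => G (a.1.1 + a.1.2 • a.2)) (hG.comp (by fun_prop))

theorem measurable_segAvg {G : E → ℝ≥0∞} (hG : Measurable G) : Measurable (segAvg μ G) :=
  Measurable.lintegral_prod_right' (measurable_setLIntegral_comp_add_smul μ _ hG)

theorem exists_segAvg_le {p : ℝ} (hp : 1 < p) (hd : (Module.finrank ℝ E : ℝ) / p < 1) :
    ∃ C : ℝ≥0, ∀ G : E → ℝ≥0∞, Measurable G → ∀ x,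
      segAvg μ G x ≤ C * (∫⁻ y, G y ^ p ∂μ) ^ (1 / p) := by
  set V := μ (Metric.ball (0 : E) 1)
  have hV : V ≠ ⊤ := measure_ball_lt_top.ne
  set D := (Module.finrank ℝ E : ℝ)
  have hp0 : 0 < p := by linarith
  have hK := lintegral_Ioo_rpow_ne_top (s := -D / p) (by rw [neg_div]; linarith)
  set K := ∫⁻ r in Set.Ioo (0 : ℝ) 1, ENNReal.ofReal r ^ (-D / p)
  refine ⟨(V ^ ((p - 1) * (1 / p)) * K).toNNReal, fun G hG x => ?_⟩
  rw [ENNReal.coe_toNNReal (ENNReal.mul_ne_top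
    (ENNReal.rpow_ne_top_of_nonneg (mul_nonneg (by linarith) (by positivity)) hV) hK)]
  calc segAvg μ G x ≤ ∫⁻ r in Set.Ioo (0 : ℝ) 1, ENNReal.ofReal r ^ (-D / p) *
        (V ^ ((p - 1) * (1 / p)) * (∫⁻ y, G y ^ p ∂μ) ^ (1 / p)) := by
        apply setLIntegral_mono' measurableSet_Ioo
        intro r hr
        have h1 := (setLIntegral_comp_add_smul_rpow_le μ (Metric.ball (0 : E) 1) hp hG x r).trans (mul_le_mul_right
          (setLIntegral_comp_add_smul_le μ _ (hG.pow_const p) x hr.1) _)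
        have h2 := ENNReal.rpow_le_rpow h1 (z := 1 / p) (by positivity)
        rw [← ENNReal.rpow_mul, mul_one_div_cancel hp0.ne', ENNReal.rpow_one,
          ENNReal.mul_rpow_of_nonneg _ _ (by positivity),
          ENNReal.mul_rpow_of_nonneg _ _ (by positivity), ← ENNReal.rpow_mul,
          ← ENNReal.rpow_mul, mul_one_div] at h2
        rw [mul_one_div] at h2 ⊢
        exact h2.trans_eq (by ring)
    _ = _ := by
      rw [lintegral_mul_const _ (by fun_prop)]
      ring

theorem exists_lintegral_segAvg_rpow_le {p q : ℝ} (hp : 1 < p) (hpq : p ≤ q)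
    (hd : (Module.finrank ℝ E : ℝ) * (1 / p - 1 / q) < 1) :
    ∃ C : ℝ≥0, ∀ G : E → ℝ≥0∞, Measurable G →
      ∫⁻ x, segAvg μ G x ^ q ∂μ ≤ C * (∫⁻ y, G y ^ p ∂μ) ^ (q / p) := by
  set V := μ (Metric.ball (0 : E) 1)
  have hV : V ≠ ⊤ := measure_ball_lt_top.ne
  set D := (Module.finrank ℝ E : ℝ)
  have hp0 : 0 < p := by linarith
  have hq1 : 1 < q := by linarith
  have hq0 : 0 < q := by linarith
  have hconj := Real.HolderConjugate.conjExponent hq1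
  set q' := q.conjExponent
  have hq'0 : 0 < q' := hconj.symm.pos
  obtain ⟨θ, hθ1, hθ2⟩ : ∃ θ, D * (1 / p - 1 / q) - 1 / q < θ ∧ θ < 1 - 1 / q :=
    exists_between (by linarith)
  have hK := lintegral_Ioo_rpow_ne_top (s := -(θ * q')) (by
    have : 1 - 1 / q = 1 / q' := by
      have := hconj.inv_add_inv_eq_one
      simp only [one_div]; linarith
    rw [this, lt_div_iff₀ hq'0] at hθ2
    linarith)
  set K := ∫⁻ r in Set.Ioo (0 : ℝ) 1, ENNReal.ofReal r ^ (-(θ * q'))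
  have hL := lintegral_Ioo_rpow_ne_top (s := θ * q + -D * (q / p - 1)) (by
    have := mul_lt_mul_of_pos_right hθ1 hq0
    have e : (D * (1 / p - 1 / q) - 1 / q) * q = D * (q / p - 1) - 1 := by
      field_simp
    rw [e] at this
    linarith)
  set L := ∫⁻ r in Set.Ioo (0 : ℝ) 1, ENNReal.ofReal r ^ (θ * q + -D * (q / p - 1))
  have hqp : 0 ≤ q / p - 1 := by
    rw [sub_nonneg, one_le_div hp0]; exact hpq
  set A := V ^ ((p - 1) * (q / p))
  have hA : A ≠ ⊤ :=
    ENNReal.rpow_ne_top_of_nonneg (mul_nonneg (by linarith) (by positivity)) hV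
  have hKq : K ^ (q / q') ≠ ⊤ := ENNReal.rpow_ne_top_of_nonneg (by positivity) hK
  refine ⟨(K ^ (q / q') * (A * V * L)).toNNReal, fun G hG => ?_⟩
  rw [ENNReal.coe_toNNReal (by finiteness)]
  set N := ∫⁻ y, G y ^ p ∂μ
  have hpt (x : E) (r : ℝ) (hr : 0 < r) :
      (∫⁻ z in Metric.ball (0 : E) 1, G (x + r • z) ∂μ) ^ q ≤
        A * (ENNReal.ofReal r ^ (-D * (q / p - 1)) * N ^ (q / p - 1)) *
          ∫⁻ z in Metric.ball (0 : E) 1, G (x + r • z) ^ p ∂μ := by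
    have h1 := setLIntegral_comp_add_smul_rpow_le μ (Metric.ball (0 : E) 1) hp hG x r
    have h2 := setLIntegral_comp_add_smul_le μ (Metric.ball (0 : E) 1) (hG.pow_const p) x hr
    set P := ∫⁻ z in Metric.ball (0 : E) 1, G (x + r • z) ^ p ∂μ
    have h3 := ENNReal.rpow_le_rpow h1 (z := q / p) (by positivity)
    rw [← ENNReal.rpow_mul, mul_div_cancel₀ _ hp0.ne',
      ENNReal.mul_rpow_of_nonneg _ _ (by positivity), ← ENNReal.rpow_mul] at h3
    refine h3.trans ?_
    rw [mul_assoc]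
    refine mul_le_mul_right ?_ _
    calc P ^ (q / p) = P ^ (q / p - 1) * P := by
          conv_rhs => rw [← ENNReal.rpow_one P, ← ENNReal.rpow_mul, one_mul]
          rw [← ENNReal.rpow_add_of_nonneg _ _ hqp zero_le_one]
          simp
      _ ≤ (ENNReal.ofReal r ^ (-D) * N) ^ (q / p - 1) * P := by gcongr
      _ = _ := by rw [ENNReal.mul_rpow_of_nonneg _ _ hqp, ← ENNReal.rpow_mul]
  have hx (x : E) : segAvg μ G x ^ q ≤ K ^ (q / q') * ∫⁻ r in Set.Ioo (0 : ℝ) 1,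
      A * N ^ (q / p - 1) * ENNReal.ofReal r ^ (θ * q + -D * (q / p - 1)) *
        ∫⁻ z in Metric.ball (0 : E) 1, G (x + r • z) ^ p ∂μ := by
    have hw := lintegral_rpow_le_weighted (volume.restrict (Set.Ioo (0 : ℝ) 1)) hconj
      (h := fun r => ∫⁻ z in Metric.ball (0 : E) 1, G (x + r • z) ∂μ)
      (w := fun r => ENNReal.ofReal r ^ θ)
      ((measurable_setLIntegral_comp_add_smul μ _ hG).comp (by fun_prop : Measurable fun r => (x, r)))
      (by fun_prop)
      ((ae_restrict_iff' measurableSet_Ioo).2 (.of_forall fun r hr => by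
        simp [ENNReal.rpow_eq_zero_iff, hr.1]))
      ((ae_restrict_iff' measurableSet_Ioo).2 (.of_forall fun r hr => by
        simp [ENNReal.rpow_eq_top_iff, hr.1]))
    have e : ∫⁻ r in Set.Ioo (0 : ℝ) 1, (ENNReal.ofReal r ^ θ)⁻¹ ^ q' = K := by
      apply lintegral_congr
      intro r
      rw [← ENNReal.rpow_neg, ← ENNReal.rpow_mul, neg_mul]
    rw [e] at hw
    refine hw.trans (mul_le_mul_right (setLIntegral_mono' measurableSet_Ioo fun r hr => ?_) _)
    refine (mul_le_mul_right (hpt x r hr.1) _).trans_eq ?_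
    rw [← ENNReal.rpow_mul, ENNReal.rpow_add _ _ (by simpa using hr.1) (by simp)]
    ring
  calc ∫⁻ x, segAvg μ G x ^ q ∂μ ≤ ∫⁻ x, (K ^ (q / q') * ∫⁻ r in Set.Ioo (0 : ℝ) 1,
      A * N ^ (q / p - 1) * ENNReal.ofReal r ^ (θ * q + -D * (q / p - 1)) *
        ∫⁻ z in Metric.ball (0 : E) 1, G (x + r • z) ^ p ∂μ) ∂μ := lintegral_mono hx
    _ = K ^ (q / q') * ∫⁻ r in Set.Ioo (0 : ℝ) 1,
      A * N ^ (q / p - 1) * ENNReal.ofReal r ^ (θ * q + -D * (q / p - 1)) * (V * N) := by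
      have hm := measurable_setLIntegral_comp_add_smul μ (Metric.ball (0 : E) 1) (hG.pow_const p)
      rw [lintegral_const_mul' _ _ hKq, lintegral_lintegral_swap]
      · congr 1
        apply lintegral_congr
        intro r
        have hr : Measurable fun x => ∫⁻ z in Metric.ball (0 : E) 1, G (x + r • z) ^ p ∂μ :=
          hm.comp (by fun_prop : Measurable fun x : E => (x, r))
        rw [lintegral_const_mul _ hr,
          lintegral_setLIntegral_comp_add_smul μ _ (hG.pow_const p)]
      · exact Measurable.aemeasurable (Measurable.mul (by fun_prop) hm)
    _ = K ^ (q / q') * (A * V * L) * (N ^ (q / p - 1) * N) := by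
      rw [lintegral_mul_const _ (by fun_prop), lintegral_const_mul _ (by fun_prop)]
      ring
    _ = _ := by
      congr 1
      conv_lhs => rw [← ENNReal.rpow_one N, ← ENNReal.rpow_mul, one_mul]
      rw [← ENNReal.rpow_add_of_nonneg _ _ hqp zero_le_one]
      simp

theorem measure_ball_mul_enorm_le_segAvg {u : E → ℝ} (hu : ContDiff ℝ 1 u) (x : E) :
    μ (Metric.ball 0 1) * ‖u x‖ₑ ≤ segAvg μ (fun y => ‖u y‖ₑ + ‖fderiv ℝ u y‖ₑ) x := by
  have hm : Measurable fun y => ‖u y‖ₑ + ‖fderiv ℝ u y‖ₑ :=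
    (hu.continuous.enorm.add (hu.continuous_fderiv one_ne_zero).enorm).measurable
  rw [segAvg, lintegral_lintegral_swap]
  · calc μ (Metric.ball 0 1) * ‖u x‖ₑ = ∫⁻ z in Metric.ball (0 : E) 1, ‖u x‖ₑ ∂μ := by
          simp [mul_comm]
      _ ≤ _ := setLIntegral_mono' measurableSet_ball fun z hz =>
          enorm_le_lintegral_segment hu x z (by simpa using (mem_ball_zero_iff.1 hz).le)
  · exact (hm.comp (by fun_prop : Measurable fun a : ℝ × E => x + a.1 • a.2)).aemeasurable

/-- The non-endpoint Sobolev embedding `W^{1,1/b} ⊆ L^{1/a}`, where `a = 0` is allowed. -/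
theorem exists_eLpNorm_le_eLpNorm_add_fderiv {a b : ℝ} (ha : 0 ≤ a) (hab : a ≤ b) (hb0 : 0 < b)
    (hb1 : b < 1) (hd : (Module.finrank ℝ E : ℝ) * (b - a) < 1) :
    ∃ C : ℝ≥0, ∀ u : E → ℝ, ContDiff ℝ 1 u →
      eLpNorm u (ENNReal.ofReal a)⁻¹ μ ≤
        C * eLpNorm (fun x => ‖u x‖ + ‖fderiv ℝ u x‖) (ENNReal.ofReal b)⁻¹ μ := by
  set V := μ (Metric.ball (0 : E) 1)
  have hV : V ≠ ⊤ := measure_ball_lt_top.ne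
  have hV0 : V ≠ 0 := (Metric.measure_ball_pos μ 0 one_pos).ne'
  have hp : 1 < b⁻¹ := (one_lt_inv₀ hb0).2 hb1
  have eb : (ENNReal.ofReal b)⁻¹ = ENNReal.ofReal b⁻¹ := (ENNReal.ofReal_inv_of_pos hb0).symm
  have hm {u : E → ℝ} (hu : ContDiff ℝ 1 u) : Measurable fun y => ‖u y‖ₑ + ‖fderiv ℝ u y‖ₑ :=
    (hu.continuous.enorm.add (hu.continuous_fderiv one_ne_zero).enorm).measurable
  have hrhs (u : E → ℝ) : eLpNorm (fun x => ‖u x‖ + ‖fderiv ℝ u x‖) (ENNReal.ofReal b)⁻¹ μ =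
      (∫⁻ x, (‖u x‖ₑ + ‖fderiv ℝ u x‖ₑ) ^ b⁻¹ ∂μ) ^ b := by
    rw [eb, eLpNorm_eq_lintegral_rpow_enorm_toReal (by simpa using hb0) (by simp),
      ENNReal.toReal_ofReal (by positivity), one_div, inv_inv]
    congr 1
    apply lintegral_congr
    intro x
    congr 1
    rw [Real.enorm_of_nonneg (by positivity), ENNReal.ofReal_add (by positivity) (by positivity),
      ofReal_norm, ofReal_norm]
  have hpt {u : E → ℝ} (hu : ContDiff ℝ 1 u) (x : E) :
      ‖u x‖ₑ ≤ V⁻¹ * segAvg μ (fun y => ‖u y‖ₑ + ‖fderiv ℝ u y‖ₑ) x := by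
    rw [mul_comm, ← div_eq_mul_inv, ENNReal.le_div_iff_mul_le (.inl hV0) (.inl hV), mul_comm]
    exact measure_ball_mul_enorm_le_segAvg μ hu x
  rcases ha.eq_or_lt with rfl | ha
  · obtain ⟨C, hC⟩ := exists_segAvg_le μ hp (by simpa using hd)
    refine ⟨(V⁻¹ * C).toNNReal, fun u hu => ?_⟩
    rw [ENNReal.coe_toNNReal (ENNReal.mul_ne_top (ENNReal.inv_ne_top.2 hV0) ENNReal.coe_ne_top),
      hrhs, ENNReal.ofReal_zero, ENNReal.inv_zero, eLpNorm_exponent_top]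
    refine eLpNormEssSup_le_of_ae_enorm_bound (.of_forall fun x => (hpt hu x).trans ?_)
    rw [mul_assoc]
    exact mul_le_mul_right ((hC _ (hm hu) x).trans_eq (by simp)) _
  · obtain ⟨C, hC⟩ := exists_lintegral_segAvg_rpow_le μ hp (q := a⁻¹) (by gcongr)
      (by simpa using hd)
    have ea : (ENNReal.ofReal a)⁻¹ = ENNReal.ofReal a⁻¹ := (ENNReal.ofReal_inv_of_pos ha).symm
    refine ⟨(V⁻¹ * C ^ a).toNNReal, fun u hu => ?_⟩
    rw [ENNReal.coe_toNNReal (ENNReal.mul_ne_top (ENNReal.inv_ne_top.2 hV0)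
      (ENNReal.rpow_ne_top_of_nonneg ha.le ENNReal.coe_ne_top)),
      hrhs, ea, eLpNorm_eq_lintegral_rpow_enorm_toReal (by simpa using ha) (by simp),
      ENNReal.toReal_ofReal (by positivity), one_div, inv_inv]
    set G := fun y => ‖u y‖ₑ + ‖fderiv ℝ u y‖ₑ
    calc (∫⁻ x, ‖u x‖ₑ ^ a⁻¹ ∂μ) ^ a ≤ (∫⁻ x, (V⁻¹ * segAvg μ G x) ^ a⁻¹ ∂μ) ^ a := by
          gcongr with x
          exact hpt hu x
      _ = V⁻¹ * (∫⁻ x, segAvg μ G x ^ a⁻¹ ∂μ) ^ a := by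
          simp_rw [ENNReal.mul_rpow_of_nonneg _ _ (inv_nonneg.2 ha.le)]
          rw [lintegral_const_mul _ ((measurable_segAvg μ (hm hu)).pow_const _),
            ENNReal.mul_rpow_of_nonneg _ _ ha.le, ← ENNReal.rpow_mul, inv_mul_cancel₀ ha.ne',
            ENNReal.rpow_one]
      _ ≤ V⁻¹ * (C * (∫⁻ y, G y ^ b⁻¹ ∂μ) ^ (a⁻¹ / b⁻¹)) ^ a := by
          gcongr
          exact hC _ (hm hu)
      _ = _ := by
          rw [ENNReal.mul_rpow_of_nonneg _ _ ha.le, ← ENNReal.rpow_mul, mul_assoc]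
          congr 3
          field_simp

end Ball
section WeightedSobolev

variable {d : ℕ}

local notation "𝔼" => EuclideanSpace ℝ (Fin d)

theorem jb_pos (x : 𝔼) : 0 < jb x := Real.sqrt_pos.2 (by positivity)

theorem jb_rpow_eq (δ : ℝ) (x : 𝔼) : jb x ^ δ = (1 + ‖x‖ ^ 2) ^ (δ / 2) := by
  rw [jb, Real.sqrt_eq_rpow, ← Real.rpow_mul (by positivity), one_div_mul_eq_div]

theorem contDiff_jb_rpow (δ : ℝ) {n : ℕ∞} : ContDiff ℝ n fun x : 𝔼 => jb x ^ δ := by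
  simp_rw [jb_rpow_eq]
  exact (contDiff_const.add (contDiff_norm_sq ℝ)).rpow_const_of_ne fun x => by positivity

theorem norm_fderiv_jb_rpow_le (δ : ℝ) (x : 𝔼) :
    ‖fderiv ℝ (fun x : 𝔼 => jb x ^ δ) x‖ ≤ |δ| * jb x ^ δ := by
  simp_rw [jb_rpow_eq]
  have h1 : HasFDerivAt (fun x : 𝔼 => 1 + ‖x‖ ^ 2) (2 • innerSL ℝ x) x :=
    (hasStrictFDerivAt_norm_sq x).hasFDerivAt.const_add 1
  have hpos : 0 < 1 + ‖x‖ ^ 2 := by positivity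
  rw [(h1.rpow_const (.inl hpos.ne')).fderiv, norm_smul, Real.norm_eq_abs, abs_mul,
    abs_of_pos (Real.rpow_pos_of_pos hpos _), Real.rpow_sub_one hpos.ne', ← Nat.cast_smul_eq_nsmul ℝ,
    norm_smul, innerSL_apply_norm, abs_div]
  have hx : ‖x‖ ≤ 1 + ‖x‖ ^ 2 := by nlinarith [sq_nonneg (‖x‖ - 1), norm_nonneg x]
  have hw : 0 < (1 + ‖x‖ ^ 2) ^ (δ / 2) := Real.rpow_pos_of_pos hpos _
  calc |δ| / |2| * ((1 + ‖x‖ ^ 2) ^ (δ / 2) / (1 + ‖x‖ ^ 2)) * (‖((2 : ℕ) : ℝ)‖ * ‖x‖)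
      = |δ| * (1 + ‖x‖ ^ 2) ^ (δ / 2) * (‖x‖ / (1 + ‖x‖ ^ 2)) := by
        simp; ring
    _ ≤ |δ| * (1 + ‖x‖ ^ 2) ^ (δ / 2) * 1 := by
        gcongr
        exact (div_le_one hpos).2 hx
    _ = _ := mul_one _

theorem norm_fderiv_le_sum_pd (u : 𝔼 → ℝ) (x : 𝔼) : ‖fderiv ℝ u x‖ ≤ ∑ i, |pd i u x| := by
  refine ContinuousLinearMap.opNorm_le_bound _ (by positivity) fun v => ?_
  have hv : v = ∑ i, v i • EuclideanSpace.single i (1 : ℝ) := by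
    have := (EuclideanSpace.basisFun (Fin d) ℝ).sum_repr v
    simpa using this.symm
  conv_lhs => rw [hv]
  rw [map_sum, Finset.sum_mul]
  refine (norm_sum_le _ _).trans (Finset.sum_le_sum fun i _ => ?_)
  rw [map_smul, norm_smul, mul_comm]
  exact mul_le_mul_of_nonneg_left (PiLp.norm_apply_le v i) (norm_nonneg _)

theorem ContDiff.pd {u : 𝔼 → ℝ} (hu : ContDiff ℝ (⊤ : ℕ∞) u) (i : Fin d) :
    ContDiff ℝ (⊤ : ℕ∞) (pd i u) :=
  (hu.fderiv_right (m := (⊤ : ℕ∞)) (by simp)).clm_apply contDiff_const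

theorem ContDiff.pdList {u : 𝔼 → ℝ} (hu : ContDiff ℝ (⊤ : ℕ∞) u) (l : List (Fin d)) :
    ContDiff ℝ (⊤ : ℕ∞) (pdList l u) := by
  induction l with
  | nil => exact hu
  | cons i l ih => exact ih.pd i

theorem HasCompactSupport.pd {u : 𝔼 → ℝ} (hu : HasCompactSupport u) (i : Fin d) :
    HasCompactSupport (pd i u) :=
  hu.fderiv_apply ℝ _

theorem HasCompactSupport.pdList {u : 𝔼 → ℝ} (hu : HasCompactSupport u) (l : List (Fin d)) :
    HasCompactSupport (pdList l u) := by
  induction l with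
  | nil => exact hu
  | cons i l ih => exact ih.pd i

theorem pd_comm {u : 𝔼 → ℝ} (hu : ContDiff ℝ (⊤ : ℕ∞) u) (i j : Fin d) :
    pd i (pd j u) = pd j (pd i u) := by
  have hd : Differentiable ℝ (fderiv ℝ u) :=
    (hu.fderiv_right (m := (⊤ : ℕ∞)) (by simp)).differentiable (by simp)
  have e (i j : Fin d) (x : 𝔼) : pd i (pd j u) x =
      fderiv ℝ (fderiv ℝ u) x (EuclideanSpace.single i 1) (EuclideanSpace.single j 1) := by
    unfold _root_.pd
    rw [fderiv_clm_apply (hd x) (differentiableAt_const _)]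
    simp
  funext x
  rw [e, e]
  exact (hu.contDiffAt.isSymmSndFDerivAt (by
    simpa using WithTop.coe_le_coe.2 (le_top : (2 : ℕ∞) ≤ ⊤))) _ _

theorem pd_add {u v : 𝔼 → ℝ} (hu : ContDiff ℝ (⊤ : ℕ∞) u) (hv : ContDiff ℝ (⊤ : ℕ∞) v)
    (i : Fin d) : pd i (fun x => u x + v x) = fun x => pd i u x + pd i v x := by
  funext x
  unfold pd
  rw [fderiv_fun_add (hu.differentiable (by simp) x) (hv.differentiable (by simp) x)]
  rfl

theorem pd_mul {u v : 𝔼 → ℝ} (hu : ContDiff ℝ (⊤ : ℕ∞) u) (hv : ContDiff ℝ (⊤ : ℕ∞) v)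
    (i : Fin d) :
    pd i (fun x => u x * v x) = fun x => u x * pd i v x + pd i u x * v x := by
  funext x
  unfold pd
  rw [fderiv_fun_mul (hu.differentiable (by simp) x) (hv.differentiable (by simp) x)]
  simp [mul_comm]

theorem pdList_add {u v : 𝔼 → ℝ} (hu : ContDiff ℝ (⊤ : ℕ∞) u) (hv : ContDiff ℝ (⊤ : ℕ∞) v)
    (l : List (Fin d)) :
    pdList l (fun x => u x + v x) = fun x => pdList l u x + pdList l v x := by
  induction l with
  | nil => rfl
  | cons i l ih => exact (congrArg (pd i) ih).trans (pd_add (hu.pdList l) (hv.pdList l) i)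

theorem pdList_append_singleton (u : 𝔼 → ℝ) (l : List (Fin d)) (i : Fin d) :
    pdList (l ++ [i]) u = pdList l (pd i u) := by
  induction l with
  | nil => rfl
  | cons j l ih => exact congrArg (pd j) ih

theorem List.Perm.pdList_eq {u : 𝔼 → ℝ} (hu : ContDiff ℝ (⊤ : ℕ∞) u) {l l' : List (Fin d)}
    (h : l.Perm l') : pdList l u = pdList l' u := by
  induction h with
  | nil => rfl
  | cons i _ ih => exact congrArg (pd i) ih
  | swap i j l => exact pd_comm (hu.pdList l) j i
  | trans _ _ h1 h2 => exact h1.trans h2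

theorem count_flatMap_replicate (α : Fin d → ℕ) (j : Fin d) :
    ((List.finRange d).flatMap fun i => List.replicate (α i) i).count j = α j := by
  rw [List.count_flatMap]
  simp only [Function.comp_def, List.count_replicate, beq_iff_eq]
  rw [← List.ofFn_eq_map, List.sum_ofFn]
  simp

theorem mD_pd {u : 𝔼 → ℝ} (hu : ContDiff ℝ (⊤ : ℕ∞) u) (α : Fin d → ℕ) (i : Fin d) :
    mD α (pd i u) = mD (α + Pi.single i 1) u := by
  unfold mD
  rw [← pdList_append_singleton]
  refine List.Perm.pdList_eq hu (List.perm_iff_count.2 fun j => ?_)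
  rw [List.count_append, count_flatMap_replicate, count_flatMap_replicate, Pi.add_apply,
    List.count_singleton, Pi.single_apply]
  rcases eq_or_ne j i with rfl | h
  · simp
  · simp [h, h.symm]

theorem mD_zero (u : 𝔼 → ℝ) : mD 0 u = u := by
  have : ((List.finRange d).flatMap fun i => List.replicate ((0 : Fin d → ℕ) i) i) = [] := by simp
  rw [mD, this, pdList]

theorem length_flatMap_replicate (α : Fin d → ℕ) :
    ((List.finRange d).flatMap fun i => List.replicate (α i) i).length = msize α := by
  rw [List.length_flatMap, msize]
  simp only [List.length_replicate]
  rw [← List.ofFn_eq_map, List.sum_ofFn]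

theorem mem_mIdx {m : ℕ} {α : Fin d → ℕ} : α ∈ mIdx d m ↔ msize α ≤ m := by
  simp only [mIdx, Finset.mem_filter, Fintype.mem_piFinset, Finset.mem_range,
    and_iff_right_iff_imp]
  exact fun h i => Nat.lt_succ_of_le ((Finset.single_le_sum (fun _ _ => Nat.zero_le _)
    (Finset.mem_univ i)).trans h)

/-- The weighted Lebesgue norm `‖⟨x⟩^δ u‖_{L^q}`. -/
def wNorm (q : ℝ≥0∞) (δ : ℝ) (u : 𝔼 → ℝ) : ℝ≥0∞ := eLpNorm (fun x => jb x ^ δ * u x) q volume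

/-- The weighted Sobolev norm `∑_{|α| ≤ m} ‖⟨x⟩^δ D^α u‖_{L^q}`. -/
def sNorm (q : ℝ≥0∞) (δ : ℝ) (m : ℕ) (u : 𝔼 → ℝ) : ℝ≥0∞ := ∑ α ∈ mIdx d m, wNorm q δ (mD α u)

theorem wNorm_le_sNorm (q : ℝ≥0∞) (δ : ℝ) (m : ℕ) (u : 𝔼 → ℝ) : wNorm q δ u ≤ sNorm q δ m u := by
  have h := Finset.single_le_sum (f := fun α => wNorm q δ (mD α u)) (fun _ _ => zero_le)
    (mem_mIdx.2 (by simp [msize]) : (0 : Fin d → ℕ) ∈ mIdx d m)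
  rwa [mD_zero] at h

theorem sNorm_mono (q : ℝ≥0∞) (δ : ℝ) {m n : ℕ} (h : m ≤ n) (u : 𝔼 → ℝ) :
    sNorm q δ m u ≤ sNorm q δ n u :=
  Finset.sum_le_sum_of_subset fun _ hα => mem_mIdx.2 ((mem_mIdx.1 hα).trans h)

theorem sNorm_pd_le (q : ℝ≥0∞) (δ : ℝ) (m : ℕ) {u : 𝔼 → ℝ} (hu : ContDiff ℝ (⊤ : ℕ∞) u)
    (i : Fin d) : sNorm q δ m (pd i u) ≤ sNorm q δ (m + 1) u := by
  unfold sNorm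
  simp_rw [mD_pd hu]
  refine (Finset.sum_map (mIdx d m) (addRightEmbedding (Pi.single i 1))
    fun α => wNorm q δ (mD α u)).symm.le.trans (Finset.sum_le_sum_of_subset fun β hβ => ?_)
  obtain ⟨α, hα, rfl⟩ := Finset.mem_map.1 hβ
  rw [mem_mIdx] at hα ⊢
  simpa [msize, Finset.sum_add_distrib] using hα

theorem aestronglyMeasurable_jb_rpow_mul (δ : ℝ) {u : 𝔼 → ℝ} (hu : Continuous u) :
    AEStronglyMeasurable (fun x => jb x ^ δ * u x) volume :=
  (((contDiff_jb_rpow δ (n := 0)).continuous).mul hu).aestronglyMeasurable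

theorem norm_add_norm_fderiv_jb_rpow_mul_le (δ : ℝ) {u : 𝔼 → ℝ} (hu : ContDiff ℝ (⊤ : ℕ∞) u)
    (x : 𝔼) :
    ‖jb x ^ δ * u x‖ + ‖fderiv ℝ (fun x => jb x ^ δ * u x) x‖ ≤
      (1 + |δ|) * ‖jb x ^ δ * u x‖ + ∑ i, ‖jb x ^ δ * pd i u x‖ := by
  have hw : 0 < jb x ^ δ := Real.rpow_pos_of_pos (jb_pos x) _
  rw [fderiv_fun_mul ((contDiff_jb_rpow δ (n := 1)).differentiable (by simp) x)
    (hu.differentiable (by simp) x)]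
  have h1 := norm_fderiv_jb_rpow_le δ x
  have h2 := norm_fderiv_le_sum_pd u x
  simp only [norm_mul, Real.norm_eq_abs, abs_of_pos hw]
  rw [← Finset.mul_sum]
  calc jb x ^ δ * |u x| + ‖jb x ^ δ • fderiv ℝ u x + u x • fderiv ℝ (fun x => jb x ^ δ) x‖
      ≤ jb x ^ δ * |u x| + (jb x ^ δ * (∑ i, |pd i u x|) + |u x| * (|δ| * jb x ^ δ)) := by
        gcongr
        refine (norm_add_le _ _).trans ?_
        rw [norm_smul, norm_smul, Real.norm_eq_abs, Real.norm_eq_abs, abs_of_pos hw]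
        gcongr
    _ = _ := by ring

theorem exists_wNorm_le {a b : ℝ} (δ : ℝ) (ha : 0 ≤ a) (hab : a ≤ b) (hb0 : 0 < b)
    (hb1 : b < 1) (hd : (d : ℝ) * (b - a) < 1) :
    ∃ C : ℝ≥0, ∀ u : 𝔼 → ℝ, ContDiff ℝ (⊤ : ℕ∞) u →
      wNorm (ENNReal.ofReal a)⁻¹ δ u ≤ C * (wNorm (ENNReal.ofReal b)⁻¹ δ u +
        ∑ i, wNorm (ENNReal.ofReal b)⁻¹ δ (pd i u)) := by
  obtain ⟨C, hC⟩ := exists_eLpNorm_le_eLpNorm_add_fderiv (E := 𝔼) volume ha hab hb0 hb1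
    (by simpa using hd)
  refine ⟨C * (1 + ‖δ‖₊), fun u hu => ?_⟩
  have hq : 1 ≤ (ENNReal.ofReal b)⁻¹ := by
    rw [ENNReal.one_le_inv]
    exact ENNReal.ofReal_le_one.2 hb1.le
  set q := (ENNReal.ofReal b)⁻¹
  have hm := aestronglyMeasurable_jb_rpow_mul δ hu.continuous
  have hmi (i : Fin d) := aestronglyMeasurable_jb_rpow_mul δ (hu.pd i).continuous
  have key : eLpNorm (fun x => ‖jb x ^ δ * u x‖ + ‖fderiv ℝ (fun x => jb x ^ δ * u x) x‖) q
      volume ≤ (1 + ‖δ‖₊ : ℝ≥0) * wNorm q δ u + ∑ i, wNorm q δ (pd i u) := by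
    calc _ ≤ eLpNorm ((fun x => (1 + |δ|) * ‖jb x ^ δ * u x‖) +
          ∑ i, fun x => ‖jb x ^ δ * pd i u x‖) q volume := by
          refine eLpNorm_mono_real fun x => ?_
          rw [Real.norm_of_nonneg (by positivity)]
          simpa using norm_add_norm_fderiv_jb_rpow_mul_le δ hu x
      _ ≤ _ := by
          refine (eLpNorm_add_le (hm.norm.const_mul _)
            (Finset.aestronglyMeasurable_sum _ fun i _ => (hmi i).norm) hq).trans
            (add_le_add ?_ ?_)
          · have := eLpNorm_const_smul_le (c := 1 + |δ|) (f := fun x => ‖jb x ^ δ * u x‖) (p := q)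
              (μ := (volume : Measure 𝔼))
            refine this.trans_eq ?_
            rw [eLpNorm_norm, wNorm]
            congr 1
            rw [Real.enorm_of_nonneg (by positivity), ENNReal.ofReal, ENNReal.coe_inj]
            ext
            simp
          · refine (eLpNorm_sum_le (fun i _ => (hmi i).norm) hq).trans_eq ?_
            simp_rw [eLpNorm_norm, wNorm]
  refine (hC _ (((contDiff_jb_rpow δ (n := 1)).mul (hu.of_le (by simp))))).trans ?_
  rw [ENNReal.coe_mul, mul_assoc]
  refine mul_le_mul_right (key.trans ?_) _
  rw [mul_add]
  gcongr
  refine le_mul_of_one_le_left zero_le ?_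
  simp

/-- `W^{s,1/c}_δ` embeds in `L^{1/a}_δ`, away from the endpoint. -/
theorem exists_wNorm_le_sNorm {c : ℝ} (δ : ℝ) (hd : 1 ≤ d) (hc0 : 0 < c) (hc1 : c < 1) (s : ℕ) :
    ∀ a : ℝ, 0 ≤ a → a ≤ c → (a = c ∨ c - s / d < a) → ∃ C : ℝ≥0, ∀ u : 𝔼 → ℝ,
      ContDiff ℝ (⊤ : ℕ∞) u →
        wNorm (ENNReal.ofReal a)⁻¹ δ u ≤ C * sNorm (ENNReal.ofReal c)⁻¹ δ s u := by
  have hd0 : (0 : ℝ) < d := by exact_mod_cast hd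
  induction s with
  | zero =>
    intro a ha hac h
    have : a = c := by
      rcases h with h | h
      · exact h
      · simp at h; linarith
    subst this
    exact ⟨1, fun u _ => by simpa using wNorm_le_sNorm _ δ 0 u⟩
  | succ s ih =>
    intro a ha hac h
    obtain ⟨b, hb0, hab, hbc, hb, hba⟩ : ∃ b, 0 < b ∧ a ≤ b ∧ b ≤ c ∧ (b = c ∨ c - s / d < b) ∧
        b - a < 1 / d := by
      have hd1 : (0 : ℝ) < 1 / d := by positivity
      rcases h with rfl | h
      · exact ⟨a, hc0, le_rfl, le_rfl, .inl rfl, by simpa using hd0⟩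
      · rcases lt_or_ge (c - a) (1 / d) with h1 | h1
        · exact ⟨c, hc0, hac, le_rfl, .inl rfl, h1⟩
        · push_cast at h
          rw [add_div] at h
          obtain ⟨b, hb1, hb2⟩ := exists_between
            (max_lt (by linarith : c - s / d < a + 1 / d) (by linarith : a < a + 1 / d))
          rw [max_lt_iff] at hb1
          exact ⟨b, ha.trans_lt hb1.2, hb1.2.le, by linarith, .inr hb1.1, by linarith⟩
    obtain ⟨C₁, hC₁⟩ := ih b (ha.trans hab) hbc hb
    obtain ⟨C₂, hC₂⟩ := exists_wNorm_le (d := d) δ ha hab hb0 (hbc.trans_lt hc1)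
      (by rwa [lt_div_iff₀' hd0] at hba)
    refine ⟨C₂ * (C₁ + d * C₁), fun u hu => (hC₂ u hu).trans ?_⟩
    rw [ENNReal.coe_mul, mul_assoc]
    refine mul_le_mul_right ?_ _
    calc _ ≤ C₁ * sNorm (ENNReal.ofReal c)⁻¹ δ (s + 1) u +
          ∑ i : Fin d, C₁ * sNorm (ENNReal.ofReal c)⁻¹ δ (s + 1) u := by
          refine add_le_add ((hC₁ u hu).trans ?_) (Finset.sum_le_sum fun i _ =>
            (hC₁ _ (hu.pd i)).trans ?_)
          · exact mul_le_mul_right (sNorm_mono _ _ (Nat.le_succ s) u) _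
          · exact mul_le_mul_right (sNorm_pd_le _ _ _ hu i) _
      _ = _ := by
          simp only [Finset.sum_const, Finset.card_univ, Fintype.card_fin, nsmul_eq_mul]
          push_cast
          ring

theorem exists_wNorm_mul_le {c : ℝ} (δ₁ δ₂ : ℝ) (hd : 1 ≤ d) (hc0 : 0 < c) (hc1 : c < 1)
    (m l : ℕ) (h : c * d < m + l) :
    ∃ C : ℝ≥0, ∀ u v : 𝔼 → ℝ, ContDiff ℝ (⊤ : ℕ∞) u → ContDiff ℝ (⊤ : ℕ∞) v →
      wNorm (ENNReal.ofReal c)⁻¹ (δ₁ + δ₂) (fun x => u x * v x) ≤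
        C * sNorm (ENNReal.ofReal c)⁻¹ δ₁ m u * sNorm (ENNReal.ofReal c)⁻¹ δ₂ l v := by
  have hd0 : (0 : ℝ) < d := by exact_mod_cast hd
  rw [← lt_div_iff₀ hd0, add_div] at h
  obtain ⟨a, ha0, hac, ha1, ha2⟩ : ∃ a : ℝ, 0 ≤ a ∧ a ≤ c ∧ (a = c ∨ c - m / d < a) ∧
      (c - a = c ∨ c - l / d < c - a) := by
    have hl0 : (0 : ℝ) ≤ l / d := by positivity
    have hm0 : (0 : ℝ) ≤ m / d := by positivity
    rcases hl0.eq_or_lt with hl | hl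
    · exact ⟨0, le_rfl, hc0.le, .inr (by linarith), .inl (by simp)⟩
    rcases hm0.eq_or_lt with hm | hm
    · exact ⟨c, hc0.le, le_rfl, .inl rfl, .inr (by linarith)⟩
    obtain ⟨a, h1, h2⟩ := exists_between
      (max_lt (lt_min (by linarith : c - m / d < c) (by linarith : c - m / d < l / d))
        (lt_min hc0 hl))
    rw [max_lt_iff] at h1
    rw [lt_min_iff] at h2
    exact ⟨a, h1.2.le, h2.1.le, .inr h1.1, .inr (by linarith)⟩
  obtain ⟨C₁, hC₁⟩ := exists_wNorm_le_sNorm (d := d) δ₁ hd hc0 hc1 m a ha0 hac ha1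
  obtain ⟨C₂, hC₂⟩ := exists_wNorm_le_sNorm (d := d) δ₂ hd hc0 hc1 l (c - a) (by linarith)
    (by linarith) ha2
  refine ⟨C₁ * C₂, fun u v hu hv => ?_⟩
  have : ENNReal.HolderTriple (ENNReal.ofReal a)⁻¹ (ENNReal.ofReal (c - a))⁻¹
      (ENNReal.ofReal c)⁻¹ := ⟨by
    simp only [inv_inv]
    rw [← ENNReal.ofReal_add ha0 (by linarith), add_sub_cancel]⟩
  have e : (fun x => jb x ^ (δ₁ + δ₂) * (u x * v x)) =
      (fun x => jb x ^ δ₁ * u x) • fun x => jb x ^ δ₂ * v x := by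
    funext x
    simp only [Pi.smul_apply', smul_eq_mul, Real.rpow_add (jb_pos x)]
    ring
  calc wNorm (ENNReal.ofReal c)⁻¹ (δ₁ + δ₂) (fun x => u x * v x)
      ≤ wNorm (ENNReal.ofReal a)⁻¹ δ₁ u * wNorm (ENNReal.ofReal (c - a))⁻¹ δ₂ v := by
        rw [wNorm, e]
        exact eLpNorm_smul_le_mul_eLpNorm (aestronglyMeasurable_jb_rpow_mul δ₂ hv.continuous)
          (aestronglyMeasurable_jb_rpow_mul δ₁ hu.continuous)
    _ ≤ _ := (mul_le_mul' (hC₁ u hu) (hC₂ v hv)).trans_eq (by push_cast; ring)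

theorem wNorm_add_le {q : ℝ≥0∞} (hq : 1 ≤ q) (δ : ℝ) {u v : 𝔼 → ℝ} (hu : Continuous u)
    (hv : Continuous v) : wNorm q δ (fun x => u x + v x) ≤ wNorm q δ u + wNorm q δ v := by
  refine le_of_eq_of_le ?_ (eLpNorm_add_le (aestronglyMeasurable_jb_rpow_mul δ hu)
    (aestronglyMeasurable_jb_rpow_mul δ hv) hq)
  rw [wNorm]
  congr 1
  funext x
  exact mul_add _ _ _

theorem exists_wNorm_pdList_mul_le {c : ℝ} (δ₁ δ₂ : ℝ) (hd : 1 ≤ d) (hc0 : 0 < c) (hc1 : c < 1)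
    (n : ℕ) : ∀ m l : ℕ, n ≤ m → n ≤ l → c * d < m + l - n →
    ∃ C : ℝ≥0, ∀ u v : 𝔼 → ℝ, ContDiff ℝ (⊤ : ℕ∞) u → ContDiff ℝ (⊤ : ℕ∞) v →
      ∀ L : List (Fin d), L.length = n →
      wNorm (ENNReal.ofReal c)⁻¹ (δ₁ + δ₂) (pdList L fun x => u x * v x) ≤
        C * sNorm (ENNReal.ofReal c)⁻¹ δ₁ m u * sNorm (ENNReal.ofReal c)⁻¹ δ₂ l v := by
  have hq : 1 ≤ (ENNReal.ofReal c)⁻¹ := by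
    rw [ENNReal.one_le_inv]
    exact ENNReal.ofReal_le_one.2 hc1.le
  induction n with
  | zero =>
    intro m l _ _ h
    obtain ⟨C, hC⟩ := exists_wNorm_mul_le (d := d) δ₁ δ₂ hd hc0 hc1 m l (by simpa using h)
    refine ⟨C, fun u v hu hv L hL => ?_⟩
    rw [List.length_eq_zero_iff.1 hL]
    exact hC u v hu hv
  | succ n ih =>
    rintro (_ | m) (_ | l) hm hl h
    · omega
    · omega
    · omega
    push_cast at h
    obtain ⟨C₁, hC₁⟩ := ih (m + 1) l (by omega) (by omega) (by push_cast; linarith)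
    obtain ⟨C₂, hC₂⟩ := ih m (l + 1) (by omega) (by omega) (by push_cast; linarith)
    refine ⟨C₁ + C₂, fun u v hu hv L hL => ?_⟩
    obtain ⟨L, i, rfl⟩ := List.eq_nil_or_concat L |>.resolve_left (by rintro rfl; simp at hL)
    have hL' : L.length = n := by simpa using hL
    rw [List.concat_eq_append, pdList_append_singleton, pd_mul hu hv,
      pdList_add (hu.mul (hv.pd i)) ((hu.pd i).mul hv)]
    refine (wNorm_add_le hq _ ((hu.mul (hv.pd i)).pdList L).continuous
      (((hu.pd i).mul hv).pdList L).continuous).trans ?_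
    rw [ENNReal.coe_add, add_mul, add_mul]
    refine add_le_add ((hC₁ u _ hu (hv.pd i) L hL').trans ?_)
      ((hC₂ _ v (hu.pd i) hv L hL').trans ?_)
    · exact mul_le_mul_right (sNorm_pd_le _ _ _ hv i) _
    · exact mul_le_mul_left (mul_le_mul_right (sNorm_pd_le _ _ _ hu i) _) _

theorem exists_sNorm_mul_le {c : ℝ} (δ₁ δ₂ : ℝ) (hd : 1 ≤ d) (hc0 : 0 < c) (hc1 : c < 1)
    {k m l : ℕ} (hkl : k ≤ l) (hkm : k ≤ m) (h : c * d < m + l - k) :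
    ∃ C : ℝ≥0, ∀ u v : 𝔼 → ℝ, ContDiff ℝ (⊤ : ℕ∞) u → ContDiff ℝ (⊤ : ℕ∞) v →
      sNorm (ENNReal.ofReal c)⁻¹ (δ₁ + δ₂) k (fun x => u x * v x) ≤
        C * sNorm (ENNReal.ofReal c)⁻¹ δ₁ m u * sNorm (ENNReal.ofReal c)⁻¹ δ₂ l v := by
  have H (α : Fin d → ℕ) : ∃ C : ℝ≥0, α ∈ mIdx d k → ∀ u v : 𝔼 → ℝ,
      ContDiff ℝ (⊤ : ℕ∞) u → ContDiff ℝ (⊤ : ℕ∞) v →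
      wNorm (ENNReal.ofReal c)⁻¹ (δ₁ + δ₂) (mD α fun x => u x * v x) ≤
        C * sNorm (ENNReal.ofReal c)⁻¹ δ₁ m u * sNorm (ENNReal.ofReal c)⁻¹ δ₂ l v := by
    by_cases hα : α ∈ mIdx d k
    · have hα' := mem_mIdx.1 hα
      have hk : (msize α : ℝ) ≤ k := by exact_mod_cast hα'
      obtain ⟨C, hC⟩ := exists_wNorm_pdList_mul_le (d := d) δ₁ δ₂ hd hc0 hc1 (msize α) m l
        (by omega) (by omega) (by linarith)
      exact ⟨C, fun _ u v hu hv => hC u v hu hv _ (length_flatMap_replicate α)⟩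
    · exact ⟨0, fun h => absurd h hα⟩
  choose C hC using H
  refine ⟨∑ α ∈ mIdx d k, C α, fun u v hu hv => ?_⟩
  rw [ENNReal.ofNNReal_finsetSum, Finset.sum_mul, Finset.sum_mul]
  exact Finset.sum_le_sum fun α hα => hC α hα u v hu hv

theorem memLp_jb_rpow_mul (q : ℝ≥0∞) (δ : ℝ) {u : 𝔼 → ℝ} (hu : Continuous u)
    (hc : HasCompactSupport u) : MemLp (fun x => jb x ^ δ * u x) q volume :=
  ((contDiff_jb_rpow δ (n := 0)).continuous.mul hu).memLp_of_hasCompactSupport hc.mul_left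

theorem sNorm_ne_top (q : ℝ≥0∞) (δ : ℝ) (m : ℕ) {u : 𝔼 → ℝ} (hu : ContDiff ℝ (⊤ : ℕ∞) u)
    (hc : HasCompactSupport u) : sNorm q δ m u ≠ ⊤ :=
  ENNReal.sum_ne_top.2 fun _ _ =>
    (memLp_jb_rpow_mul q δ (hu.pdList _).continuous (hc.pdList _)).eLpNorm_ne_top

theorem toReal_sNorm {p : ℝ} (hp : 1 < p) (δ : ℝ) (m : ℕ) {u : 𝔼 → ℝ}
    (hu : ContDiff ℝ (⊤ : ℕ∞) u) (hc : HasCompactSupport u) :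
    (sNorm (ENNReal.ofReal p) δ m u).toReal =
      ∑ α ∈ mIdx d m, (∫ x, (jb x ^ δ * |mD α u x|) ^ p) ^ (1 / p) := by
  have hp0 : 0 < p := by linarith
  have hmem (α : Fin d → ℕ) :
      MemLp (fun x => jb x ^ δ * mD α u x) (ENNReal.ofReal p) volume :=
    memLp_jb_rpow_mul _ δ (hu.pdList _).continuous (hc.pdList _)
  have htop (α : Fin d → ℕ) : wNorm (ENNReal.ofReal p) δ (mD α u) ≠ ⊤ := (hmem α).eLpNorm_ne_top
  rw [sNorm, ENNReal.toReal_sum fun α _ => htop α]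
  refine Finset.sum_congr rfl fun α _ => ?_
  have h := (hmem α).eLpNorm_eq_integral_rpow_norm (by simpa using hp0) (by simp)
  refine (congrArg ENNReal.toReal h).trans ?_
  rw [ENNReal.toReal_ofReal hp0.le, one_div, ENNReal.toReal_ofReal (by positivity)]
  congr 2
  funext x
  rw [norm_mul, Real.norm_eq_abs, Real.norm_eq_abs,
    abs_of_pos (Real.rpow_pos_of_pos (jb_pos x) _)]

end WeightedSobolev

/-- Pointwise multiplication is bounded
`H^{m,p}_{δ₁}(ℝ^d) × H^{ℓ,p}_{δ₂}(ℝ^d) → H^{k,p}_{δ₁+δ₂}(ℝ^d)` for `0 ≤ k ≤ ℓ ≤ m`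
and `(m+ℓ-k)p > d`. -/
theorem weighted_H_multiplication
    (d m l k : ℕ) (hd : 1 ≤ d) (p δ₁ δ₂ : ℝ) (hp : 1 < p)
    (hkl : k ≤ l) (hlm : l ≤ m)
    (hcase : (d : ℝ) < ((m : ℝ) + (l : ℝ) - (k : ℝ)) * p) :
    ∃ C : ℝ, 0 < C ∧ ∀ f g : EuclideanSpace ℝ (Fin d) → ℝ,
      ContDiff ℝ (⊤ : ℕ∞) f → HasCompactSupport f → ContDiff ℝ (⊤ : ℕ∞) g → HasCompactSupport g →
      ∑ α ∈ mIdx d k,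
          (∫ x, (jb x ^ (δ₁ + δ₂) * |mD α (fun y => f y * g y) x|) ^ p) ^ (1 / p) ≤
        C * (∑ α ∈ mIdx d m, (∫ x, (jb x ^ δ₁ * |mD α f x|) ^ p) ^ (1 / p)) *
            (∑ β ∈ mIdx d l, (∫ x, (jb x ^ δ₂ * |mD β g x|) ^ p) ^ (1 / p)) := by
  have hp0 : 0 < p := by linarith
  have hd0 : (0 : ℝ) < d := by exact_mod_cast hd
  have hq : (ENNReal.ofReal p⁻¹)⁻¹ = ENNReal.ofReal p := by
    rw [ENNReal.ofReal_inv_of_pos hp0, inv_inv]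
  obtain ⟨C, hC⟩ := exists_sNorm_mul_le (d := d) δ₁ δ₂ hd (inv_pos.2 hp0) (inv_lt_one_of_one_lt₀ hp)
    hkl (hkl.trans hlm) (by rwa [inv_mul_eq_div, div_lt_iff₀ hp0])
  rw [hq] at hC
  refine ⟨C + 1, by positivity, fun f g hf hfc hg hgc => ?_⟩
  rw [← toReal_sNorm hp (δ₁ + δ₂) k (hf.mul hg) hfc.mul_right, ← toReal_sNorm hp δ₁ m hf hfc,
    ← toReal_sNorm hp δ₂ l hg hgc]
  have h := ENNReal.toReal_mono (by
    have := sNorm_ne_top (ENNReal.ofReal p) δ₁ m hf hfc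
    have := sNorm_ne_top (ENNReal.ofReal p) δ₂ l hg hgc
    finiteness) (hC f g hf hg)
  rw [ENNReal.toReal_mul, ENNReal.toReal_mul, ENNReal.coe_toReal] at h
  refine h.trans ?_
  gcongr
  linarith
end
end

section
/- Let d ≥ 1, 1 < p < ∞, δ ∈ ℝ, and let m ≥ 0 be an integer. Assume either mp < d and p ≤ q ≤ dp/(d−mp), or mp = d and p ≤ q < ∞. Then there exists a constant C = C(d,m,p,q,δ) such that for all R > 0 and all f ∈ C^m(ℝ^d), (∫_{A_R} (|x|^{δ−d/q} |f(x)|)^q dx)^{1/q} ≤ C · Σ_{j=0}^{m} (∫_{A_R} (|x|^{δ−d/p+j} |∇^j f(x)|)^p dx)^{1/p}, where A_R = {x ∈ ℝ^d : R < |x| < 2R}. In particular the constant C is independent of R. -/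
open MeasureTheory Filter
open scoped BigOperators ENNReal Topology

noncomputable section

/-- The Gagliardo grid-lines inequality on Euclidean space: a function dominated by the integral of
`g` over every axis-parallel line is controlled by the integral of `g`. -/
theorem lintegral_rpow_le_of_le_lintegral_line {d : ℕ} {r : ℝ} (hr : (d : ℝ).HolderConjugate r)
    {g h : EuclideanSpace ℝ (Fin d) → ℝ≥0∞} (hg : Measurable g)
    (hgh : ∀ x i, h x ≤ ∫⁻ t : ℝ, g (x + t • EuclideanSpace.single i 1)) :
    ∫⁻ x, h x ^ r ≤ (∫⁻ x, g x) ^ r := by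
  have hd : (1 : ℝ) < d := hr.lt
  have hmp := PiLp.volume_preserving_toLp (Fin d)
  have hme : MeasurableEmbedding (WithLp.toLp 2 : (Fin d → ℝ) → EuclideanSpace ℝ (Fin d)) :=
    (MeasurableEquiv.toLp 2 (Fin d → ℝ)).measurableEmbedding
  rw [← hmp.lintegral_comp_emb hme, ← hmp.lintegral_comp hg]
  have hline : ∀ (y : Fin d → ℝ) (i : Fin d),
      h (WithLp.toLp 2 y) ≤ ∫⁻ t : ℝ, g (WithLp.toLp 2 (Function.update y i t)) := by
    intro y i
    refine (hgh _ i).trans_eq ?_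
    rw [← lintegral_add_left_eq_self
      (fun t : ℝ => g (WithLp.toLp 2 (Function.update y i t))) (y i)]
    congr 1 with t
    congr 1
    ext j
    by_cases hj : j = i
    · subst hj; simp
    · simp [hj]
  have hr' : (Fintype.card (Fin d) : ℝ).HolderConjugate r := by simpa using hr
  refine le_trans (lintegral_mono fun y => ?_)
    (lintegral_prod_lintegral_pow_le (fun _ : Fin d => (volume : Measure ℝ)) hr'
      (hg.comp hme.measurable))
  have key : h (WithLp.toLp 2 y) ^ r
      = ∏ _i : Fin d, h (WithLp.toLp 2 y) ^ ((1 : ℝ) / (Fintype.card (Fin d) - 1 : ℝ)) := by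
    rw [Finset.prod_const, Finset.card_univ, Fintype.card_fin, ← ENNReal.rpow_natCast,
      ← ENNReal.rpow_mul, hr.conjugate_eq]
    congr 1
    have : (d : ℝ) - 1 ≠ 0 := by linarith
    field_simp
  simp only [key]
  have : (0 : ℝ) ≤ 1 / (Fintype.card (Fin d) - 1 : ℝ) := by
    rw [Fintype.card_fin]
    have : 0 < (d : ℝ) - 1 := by linarith
    positivity
  exact Finset.prod_le_prod' fun i _ => ENNReal.rpow_le_rpow (hline y i) this

/-- The fundamental theorem of calculus for `‖φ‖ ^ γ`, for a path ending at zero. -/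
theorem enorm_rpow_le_lintegral_deriv {F : Type*} [NormedAddCommGroup F] [NormedSpace ℝ F]
    {γ T : ℝ} (hγ : 1 < γ) (hT : 0 ≤ T) {φ φ' : ℝ → F}
    (hφ : ∀ t ∈ Set.Icc 0 T, HasDerivAt φ (φ' t) t)
    (hφ' : ContinuousOn φ' (Set.Icc 0 T)) (hzero : φ T = 0) :
    ‖φ 0‖ₑ ^ γ ≤ ∫⁻ t in Set.Icc 0 T, ENNReal.ofReal γ * (‖φ t‖ₑ ^ (γ - 1) * ‖φ' t‖ₑ) := by
  obtain ⟨l, hl, hl0⟩ := exists_dual_vector'' ℝ (φ 0)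
  have hder : ∀ t ∈ Set.Icc 0 T, HasDerivAt (fun t => |l (φ t)| ^ γ)
      (γ * |l (φ t)| ^ (γ - 2) * l (φ t) * l (φ' t)) t := fun t ht =>
    HasDerivAt.comp (h₂ := fun s : ℝ => |s| ^ γ) (h := fun t => l (φ t)) t
      (hasDerivAt_abs_rpow (l (φ t)) hγ) (l.hasFDerivAt.comp_hasDerivAt t (hφ t ht))
  have hcont : ContinuousOn (fun t => γ * |l (φ t)| ^ (γ - 2) * l (φ t) * l (φ' t))
      (Set.Icc 0 T) := by
    have h1 : Continuous fun s : ℝ => γ * |s| ^ (γ - 2) * s := by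
      have := (contDiff_norm_rpow (E := ℝ) hγ).continuous_deriv le_rfl
      refine this.congr fun s => ?_
      simpa using (hasDerivAt_abs_rpow s hγ).deriv
    have h2 : ContinuousOn φ (Set.Icc 0 T) := fun t ht =>
      (hφ t ht).continuousAt.continuousWithinAt
    exact (h1.comp_continuousOn (l.continuous.comp_continuousOn h2)).mul
      (l.continuous.comp_continuousOn hφ')
  have hftc := intervalIntegral.integral_eq_sub_of_hasDerivAt
    (f := fun t => |l (φ t)| ^ γ) (by rwa [Set.uIcc_of_le hT])
    (ContinuousOn.intervalIntegrable (by rwa [Set.uIcc_of_le hT]))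
  simp only [hzero, hl0, map_zero, abs_zero, Real.zero_rpow (by linarith : γ ≠ 0)] at hftc
  have hl0' : ‖φ 0‖ₑ ^ γ = ‖-(∫ t in (0 : ℝ)..T,
      γ * |l (φ t)| ^ (γ - 2) * l (φ t) * l (φ' t))‖ₑ := by
    rw [hftc]
    simp only [RCLike.ofReal_real_eq_id, id, zero_sub, neg_neg, abs_norm]
    rw [Real.enorm_eq_ofReal (by positivity), ← ofReal_norm,
      ENNReal.ofReal_rpow_of_nonneg (norm_nonneg _) (by linarith)]
  rw [hl0', enorm_neg, intervalIntegral.integral_of_le hT]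
  refine (enorm_integral_le_lintegral_enorm _).trans ?_
  rw [setLIntegral_congr (Ioc_ae_eq_Icc : Set.Ioc 0 T =ᵐ[volume] _)]
  refine lintegral_mono fun t => ?_
  have hle : ∀ v : F, |l v| ≤ ‖v‖ := fun v => by
    simpa using l.le_of_opNorm_le hl v
  have hreal : ‖γ * |l (φ t)| ^ (γ - 2) * l (φ t) * l (φ' t)‖
      ≤ γ * (‖φ t‖ ^ (γ - 1) * ‖φ' t‖) := by
    have habs : |l (φ t)| ^ (γ - 2) * |l (φ t)| ≤ ‖φ t‖ ^ (γ - 1) := by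
      rcases eq_or_lt_of_le (abs_nonneg (l (φ t))) with h0 | h0
      · rw [← h0, mul_zero]; positivity
      · rw [← Real.rpow_add_one h0.ne']
        ring_nf
        rw [show -1 + γ = γ - 1 by ring]
        exact Real.rpow_le_rpow h0.le (hle _) (by linarith)
    rw [norm_mul, norm_mul, norm_mul, Real.norm_of_nonneg (by linarith : 0 ≤ γ),
      Real.norm_of_nonneg (by positivity : 0 ≤ |l (φ t)| ^ (γ - 2)), mul_assoc, mul_assoc,
      ← mul_assoc (|l (φ t)| ^ (γ - 2))]
    gcongr
    · exact habs
    · exact hle _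
  rw [← ofReal_norm]
  refine (ENNReal.ofReal_le_ofReal hreal).trans_eq ?_
  rw [ENNReal.ofReal_mul (by linarith), ENNReal.ofReal_mul (by positivity),
    ← ENNReal.ofReal_rpow_of_nonneg (norm_nonneg _) (by linarith), ofReal_norm,
    ofReal_norm]

/-- The open annulus `{R < |x| < 2R}`. -/
def annulus (d : ℕ) (R : ℝ) : Set (EuclideanSpace ℝ (Fin d)) := {x | R < ‖x‖ ∧ ‖x‖ < 2 * R}

theorem measurableSet_annulus (d : ℕ) (R : ℝ) : MeasurableSet (annulus d R) :=
  ((isOpen_lt continuous_const continuous_norm).inter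
    (isOpen_lt continuous_norm continuous_const)).measurableSet

theorem volume_annulus_lt_top (d : ℕ) (R : ℝ) : volume (annulus d R) < ∞ :=
  (measure_mono fun x hx => by simpa using hx.2.le).trans_lt
    (measure_closedBall_lt_top (x := (0 : EuclideanSpace ℝ (Fin d))) (r := 2 * R))

instance isFiniteMeasure_restrict_annulus (d : ℕ) (R : ℝ) :
    IsFiniteMeasure ((volume : Measure (EuclideanSpace ℝ (Fin d))).restrict (annulus d R)) :=
  ⟨by simpa using volume_annulus_lt_top d R⟩

/-- In every coordinate direction there is an orientation along which the norm does not decrease. -/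
theorem exists_sign_norm_le_norm_add_smul_single {d : ℕ} (x : EuclideanSpace ℝ (Fin d))
    (i : Fin d) : ∃ σ : ℝ, |σ| = 1 ∧ ∀ t : ℝ, 0 ≤ t →
      ‖x‖ ≤ ‖x + (σ * t) • EuclideanSpace.single i (1 : ℝ)‖ ∧
      t ≤ ‖x + (σ * t) • EuclideanSpace.single i (1 : ℝ)‖ := by
  have hsq : ∀ a : ℝ, ‖x + a • EuclideanSpace.single i (1 : ℝ)‖ ^ 2
      = ‖x‖ ^ 2 + 2 * (a * x i) + a ^ 2 := by
    intro a
    rw [norm_add_sq_real, inner_smul_right, EuclideanSpace.inner_single_right, norm_smul]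
    simp
  obtain ⟨σ, hσ, hσx⟩ : ∃ σ : ℝ, |σ| = 1 ∧ 0 ≤ σ * x i := by
    rcases le_total 0 (x i) with h | h
    · exact ⟨1, by simp, by simpa using h⟩
    · exact ⟨-1, by simp, by simpa using h⟩
  have hσ2 : σ ^ 2 = 1 := by rw [← sq_abs, hσ, one_pow]
  refine ⟨σ, hσ, fun t ht => ?_⟩
  have h := hsq (σ * t)
  have hnn : 0 ≤ σ * t * x i := by nlinarith [mul_nonneg ht hσx]
  have h2 : (σ * t) ^ 2 = t ^ 2 := by rw [mul_pow, hσ2, one_mul]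
  constructor
  · exact le_of_sq_le_sq (by nlinarith [sq_nonneg t]) (norm_nonneg _)
  · exact le_of_sq_le_sq (by nlinarith [sq_nonneg ‖x‖]) (norm_nonneg _)

section Exterior

variable {d : ℕ} {F : Type*} [NormedAddCommGroup F] [NormedSpace ℝ F]

theorem isOpen_one_lt_norm (d : ℕ) : IsOpen {x : EuclideanSpace ℝ (Fin d) | 1 < ‖x‖} :=
  isOpen_lt continuous_const continuous_norm

/-- A function on the exterior of the unit ball which vanishes for `2 ≤ ‖x‖` is controlled by the
integral of its derivative over the part of any axis-parallel line lying in the annulus. -/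
theorem enorm_rpow_le_lintegral_line {v : EuclideanSpace ℝ (Fin d) → F} {γ : ℝ} (hγ : 1 < γ)
    (hv : ContDiffOn ℝ 1 v {x | 1 < ‖x‖}) (hv0 : ∀ x, 2 ≤ ‖x‖ → v x = 0)
    {x : EuclideanSpace ℝ (Fin d)} (hx : 1 < ‖x‖) (i : Fin d) :
    ‖v x‖ₑ ^ γ ≤ ∫⁻ t : ℝ, (annulus d 1).indicator
      (fun y => ENNReal.ofReal γ * (‖v y‖ₑ ^ (γ - 1) * ‖fderiv ℝ v y‖ₑ))
      (x + t • EuclideanSpace.single i 1) := by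
  obtain ⟨σ, hσ, hray⟩ := exists_sign_norm_le_norm_add_smul_single x i
  set e : EuclideanSpace ℝ (Fin d) := EuclideanSpace.single i 1
  set G : EuclideanSpace ℝ (Fin d) → ℝ≥0∞ := (annulus d 1).indicator
    (fun y => ENNReal.ofReal γ * (‖v y‖ₑ ^ (γ - 1) * ‖fderiv ℝ v y‖ₑ)) with hG
  have hmem : ∀ t ∈ Set.Icc (0 : ℝ) 2, 1 < ‖x + (σ * t) • e‖ := fun t ht =>
    hx.trans_le (hray t ht.1).1
  have hpath : ∀ t : ℝ, HasDerivAt (fun t => x + (σ * t) • e) (σ • e) t := fun t => by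
    simpa using (((hasDerivAt_id t).const_mul σ).smul_const e).const_add x
  have hderiv : ∀ t ∈ Set.Icc (0 : ℝ) 2, HasDerivAt (fun t => v (x + (σ * t) • e))
      (fderiv ℝ v (x + (σ * t) • e) (σ • e)) t := fun t ht =>
    (((hv.differentiableOn one_ne_zero).differentiableAt
      ((isOpen_one_lt_norm d).mem_nhds (hmem t ht))).hasFDerivAt).comp_hasDerivAt t (hpath t)
  have hcont : ContinuousOn (fun t => fderiv ℝ v (x + (σ * t) • e) (σ • e))
      (Set.Icc (0 : ℝ) 2) := by
    refine ContinuousOn.clm_apply ?_ continuousOn_const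
    exact (hv.continuousOn_fderiv_of_isOpen (isOpen_one_lt_norm d) le_rfl).comp
      (by fun_prop) hmem
  have h := enorm_rpow_le_lintegral_deriv hγ zero_le_two hderiv hcont (hv0 _ (hray 2 zero_le_two).2)
  simp only [mul_zero, zero_smul, add_zero] at h
  calc ‖v x‖ₑ ^ γ ≤ _ := h
    _ ≤ ∫⁻ t in Set.Icc (0 : ℝ) 2, G (x + (σ * t) • e) := by
        refine setLIntegral_mono' measurableSet_Icc fun t ht => ?_
        by_cases ht2 : ‖x + (σ * t) • e‖ < 2
        · have hmem' : x + (σ * t) • e ∈ annulus d 1 := ⟨hmem t ht, by simpa using ht2⟩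
          rw [hG, Set.indicator_of_mem hmem']
          gcongr
          rw [← ofReal_norm, ← ofReal_norm]
          refine ENNReal.ofReal_le_ofReal ((ContinuousLinearMap.le_opNorm _ _).trans_eq ?_)
          simp [norm_smul, hσ, e]
        · rw [hv0 _ (not_lt.1 ht2)]
          simp [ENNReal.zero_rpow_of_pos (sub_pos.2 hγ)]
    _ ≤ ∫⁻ t : ℝ, G (x + (σ * t) • e) := setLIntegral_le_lintegral _ _
    _ = ∫⁻ t : ℝ, G (x + t • e) := by
        rcases eq_or_eq_neg_of_abs_eq hσ with rfl | rfl
        · simp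
        · simpa using lintegral_neg_eq_self (μ := (volume : Measure ℝ)) (fun t : ℝ => G (x + t • e))

/-- The Sobolev inequality for functions on the exterior of the unit ball which vanish for
`2 ≤ ‖x‖`, with no condition at the unit sphere. -/
theorem eLpNorm'_le_eLpNorm'_fderiv_of_eq_zero {v : EuclideanSpace ℝ (Fin d) → F} {p q : ℝ}
    (hp : 1 < p) (hpd : p < d) (hq : 1 / q = 1 / p - 1 / d)
    (hv : ContDiffOn ℝ 1 v {x | 1 < ‖x‖}) (hv0 : ∀ x, 2 ≤ ‖x‖ → v x = 0)
    {M : ℝ} (hM : ∀ x ∈ annulus d 1, ‖v x‖ ≤ M) :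
    eLpNorm' v q (volume.restrict (annulus d 1)) ≤ ENNReal.ofReal (q * (1 - 1 / d)) *
      eLpNorm' (fderiv ℝ v) p (volume.restrict (annulus d 1)) := by
  have hd1 : (1 : ℝ) < d := hp.trans hpd
  have hd0 : (0 : ℝ) < d := by linarith
  have hq0 : 0 < q := by
    have : 0 < 1 / q := by rw [hq, sub_pos]; exact one_div_lt_one_div_of_lt (by linarith) hpd
    simpa using this
  set γ : ℝ := q * (1 - 1 / d) with hγdef
  have hconj := Real.HolderConjugate.conjExponent hp
  set p' : ℝ := Real.conjExponent p
  have hp'inv : 1 / p' = 1 - 1 / p := by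
    have := hconj.inv_add_inv_eq_one
    simp only [one_div]; linarith
  have hp'0 : 0 < p' := hconj.symm.pos
  have hγ1 : γ - 1 = q / p' := by
    have : γ - 1 = q * (1 - 1 / d - 1 / q) := by rw [hγdef]; field_simp
    rw [this, hq, div_eq_mul_one_div q p', hp'inv]; ring
  have hγ : 1 < γ := by
    have : 0 < q / p' := by positivity
    linarith
  have hγp' : (γ - 1) * p' = q := by rw [hγ1]; field_simp
  set r : ℝ := d / (d - 1) with hr
  have hrconj : (d : ℝ).HolderConjugate r := Real.HolderConjugate.conjExponent hd1
  have hr0 : 0 < r := hrconj.symm.pos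
  have hγr : γ * r = q := by
    rw [hγdef, hr]; have : (d : ℝ) - 1 ≠ 0 := by linarith
    field_simp
  have hA := measurableSet_annulus d 1
  have hAsub : annulus d 1 ⊆ {x | 1 < ‖x‖} := fun x hx => hx.1
  set μ := volume.restrict (annulus d 1) with hμ
  have hvc : ContinuousOn v (annulus d 1) := hv.continuousOn.mono hAsub
  have hvc' : ContinuousOn (fderiv ℝ v) (annulus d 1) :=
    (hv.continuousOn_fderiv_of_isOpen (isOpen_one_lt_norm d) le_rfl).mono hAsub
  have hmeas : ∀ w : EuclideanSpace ℝ (Fin d) → ℝ≥0∞, ContinuousOn w (annulus d 1) →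
      Measurable ((annulus d 1).indicator w) := fun w hw => by
    classical
    rw [← Set.piecewise_eq_indicator]
    exact hw.measurable_piecewise continuousOn_const hA
  have hm1 := hmeas _ hvc.enorm
  have hm2 := hmeas _ hvc'.enorm
  set G : EuclideanSpace ℝ (Fin d) → ℝ≥0∞ :=
    fun y => ENNReal.ofReal γ * (‖v y‖ₑ ^ (γ - 1) * ‖fderiv ℝ v y‖ₑ) with hG
  have hGm : Measurable ((annulus d 1).indicator G) := by
    have : (annulus d 1).indicator G = fun x => ENNReal.ofReal γ *
        (((annulus d 1).indicator (fun y => ‖v y‖ₑ) x) ^ (γ - 1) *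
          (annulus d 1).indicator (fun y => ‖fderiv ℝ v y‖ₑ) x) := by
      ext x
      by_cases hx : x ∈ annulus d 1 <;> simp [hx, hG]
    rw [this]
    fun_prop
  have hgrid := lintegral_rpow_le_of_le_lintegral_line hrconj hGm
    (h := (annulus d 1).indicator fun x => ‖v x‖ₑ ^ γ) (fun x i => by
      by_cases hx : x ∈ annulus d 1
      · rw [Set.indicator_of_mem hx]
        exact enorm_rpow_le_lintegral_line hγ hv hv0 hx.1 i
      · simp [hx])
  have hlhs : (fun x => (annulus d 1).indicator (fun x => ‖v x‖ₑ ^ γ) x ^ r)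
      = (annulus d 1).indicator fun x => ‖v x‖ₑ ^ q := by
    ext x
    by_cases hx : x ∈ annulus d 1
    · simp [hx, ← ENNReal.rpow_mul, hγr]
    · simp [hx, ENNReal.zero_rpow_of_pos hr0]
  rw [hlhs, lintegral_indicator hA, lintegral_indicator hA, hG, ← hμ,
    lintegral_const_mul' _ _ ENNReal.ofReal_ne_top] at hgrid
  have hholder := ENNReal.lintegral_mul_le_Lp_mul_Lq μ hconj.symm
    (f := fun x => ‖v x‖ₑ ^ (γ - 1)) (g := fun x => ‖fderiv ℝ v x‖ₑ)
    ((hvc.enorm.aemeasurable hA).pow_const _) (hvc'.enorm.aemeasurable hA)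
  simp only [Pi.mul_apply, ← ENNReal.rpow_mul, hγp'] at hholder
  set N : ℝ≥0∞ := ∫⁻ x, ‖v x‖ₑ ^ q ∂μ with hN
  have hNtop : N ≠ ∞ := by
    refine ((setLIntegral_mono' hA (g := fun _ => ENNReal.ofReal M ^ q) fun x hx => ?_).trans_lt
      ?_).ne
    · rw [← ofReal_norm]
      exact ENNReal.rpow_le_rpow (ENNReal.ofReal_le_ofReal (hM x hx)) hq0.le
    · rw [setLIntegral_const]
      exact ENNReal.mul_lt_top (ENNReal.rpow_lt_top_of_nonneg hq0.le ENNReal.ofReal_ne_top)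
        (volume_annulus_lt_top d 1)
  unfold eLpNorm'
  rw [← hN]
  set D : ℝ≥0∞ := (∫⁻ x, ‖fderiv ℝ v x‖ₑ ^ p ∂μ) ^ (1 / p)
  by_cases hN0 : N = 0
  · rw [hN0, ENNReal.zero_rpow_of_pos (by positivity)]; exact zero_le
  have hmain : N ^ (1 / r) ≤ ENNReal.ofReal γ * D * N ^ (1 / p') := by
    calc N ^ (1 / r) ≤ ((ENNReal.ofReal γ * (N ^ (1 / p') * D)) ^ r) ^ (1 / r) := by
          refine ENNReal.rpow_le_rpow (hgrid.trans ?_) (by positivity)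
          gcongr
      _ = _ := by
          rw [← ENNReal.rpow_mul, mul_one_div_cancel hr0.ne', ENNReal.rpow_one]
          ring
  have hrinv : 1 / r = 1 / q + 1 / p' := by
    rw [hq, hp'inv, hr]; field_simp; ring
  rw [hrinv, ENNReal.rpow_add _ _ hN0 hNtop] at hmain
  exact (ENNReal.mul_le_mul_iff_left
    (ENNReal.rpow_pos (pos_iff_ne_zero.2 hN0) hNtop).ne'
    (ENNReal.rpow_ne_top_of_nonneg (by positivity) hNtop)).1 hmain

end Exterior

section Annulus

variable {d : ℕ}

/-- The Sobolev inequality on the inner part of the annulus. -/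
theorem exists_eLpNorm'_inner_le {p q : ℝ} (hp : 1 < p) (hpd : p < d)
    (hq : 1 / q = 1 / p - 1 / d) :
    ∃ C : ℝ≥0∞, C ≠ ∞ ∧ ∀ (F : Type) [NormedAddCommGroup F] [NormedSpace ℝ F]
      (u : EuclideanSpace ℝ (Fin d) → F), ContDiffOn ℝ 1 u {0}ᶜ →
      eLpNorm' u q (volume.restrict (annulus d 1 ∩ Metric.closedBall 0 (3 / 2))) ≤
        C * (eLpNorm' u p (volume.restrict (annulus d 1)) +
          eLpNorm' (fderiv ℝ u) p (volume.restrict (annulus d 1))) := by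
  let χ : ContDiffBump (0 : EuclideanSpace ℝ (Fin d)) := ⟨3 / 2, 2, by norm_num, by norm_num⟩
  have hχc : ContDiff ℝ 1 (χ : EuclideanSpace ℝ (Fin d) → ℝ) := χ.contDiff
  obtain ⟨K, hK⟩ : ∃ K : ℝ, ∀ x, ‖fderiv ℝ χ x‖ ≤ K :=
    (χ.hasCompactSupport.fderiv ℝ).exists_bound_of_continuous (hχc.continuous_fderiv one_ne_zero)
  set K' : ℝ := max K 1
  have hq0 : 0 < q := by
    have : 0 < 1 / q := by rw [hq, sub_pos]; exact one_div_lt_one_div_of_lt (by linarith) hpd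
    simpa using this
  refine ⟨ENNReal.ofReal (q * (1 - 1 / d)) * ENNReal.ofReal K',
    ENNReal.mul_ne_top ENNReal.ofReal_ne_top ENNReal.ofReal_ne_top, fun F _ _ u hu => ?_⟩
  have hopen : IsOpen ({0}ᶜ : Set (EuclideanSpace ℝ (Fin d))) := isOpen_compl_singleton
  have hne : ∀ x : EuclideanSpace ℝ (Fin d), 1 < ‖x‖ → x ∈ ({0}ᶜ : Set _) := by
    rintro x hx rfl
    simp at hx
    linarith
  have hA := measurableSet_annulus d 1
  have hAne : annulus d 1 ⊆ {0}ᶜ := fun x hx => hne x hx.1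
  set μ := volume.restrict (annulus d 1) with hμ
  set v : EuclideanSpace ℝ (Fin d) → F := fun x => χ x • u x
  have hv : ContDiffOn ℝ 1 v {0}ᶜ := hχc.contDiffOn.smul hu
  have hv0 : ∀ x, 2 ≤ ‖x‖ → v x = 0 := fun x hx => by
    simp only [v]
    rw [χ.zero_of_le_dist (by simpa [χ] using hx), zero_smul]
  obtain ⟨M, hM⟩ : ∃ M, ∀ x ∈ annulus d 1, ‖v x‖ ≤ M := by
    have hcpt : IsCompact (Metric.closedBall (0 : EuclideanSpace ℝ (Fin d)) 2 ∩ {x | 1 ≤ ‖x‖}) :=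
      (isCompact_closedBall _ _).inter_right (isClosed_le continuous_const continuous_norm)
    obtain ⟨M, hM⟩ := hcpt.exists_bound_of_continuousOn (f := v)
      (hv.continuousOn.mono fun x hx h0 => by
        have h1 : 1 ≤ ‖x‖ := hx.2
        rw [Set.mem_singleton_iff.1 h0, norm_zero] at h1
        linarith)
    exact ⟨M, fun x hx => hM x ⟨by simpa using hx.2.le, hx.1.le⟩⟩
  have hsob := eLpNorm'_le_eLpNorm'_fderiv_of_eq_zero hp hpd hq
    (hv.mono hne) hv0 hM
  have hleft : eLpNorm' u q (volume.restrict (annulus d 1 ∩ Metric.closedBall 0 (3 / 2)))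
      ≤ eLpNorm' v q μ := by
    unfold eLpNorm'
    refine ENNReal.rpow_le_rpow ?_ (by positivity)
    calc _ = ∫⁻ x in annulus d 1 ∩ Metric.closedBall 0 (3 / 2), ‖v x‖ₑ ^ q := by
          refine setLIntegral_congr_fun (hA.inter measurableSet_closedBall) fun x hx => ?_
          simp only [v]
          rw [χ.one_of_mem_closedBall hx.2, one_smul]
      _ ≤ _ := lintegral_mono_set Set.inter_subset_left
  have hum : AEStronglyMeasurable u μ := (hu.continuousOn.mono hAne).aestronglyMeasurable hA
  have hum' : AEStronglyMeasurable (fderiv ℝ u) μ :=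
    ((hu.continuousOn_fderiv_of_isOpen hopen le_rfl).mono hAne).aestronglyMeasurable hA
  have hright : eLpNorm' (fderiv ℝ v) p μ ≤
      ENNReal.ofReal K' * (eLpNorm' u p μ + eLpNorm' (fderiv ℝ u) p μ) := by
    calc eLpNorm' (fderiv ℝ v) p μ
        ≤ eLpNorm' (K' • ((fun x => ‖u x‖) + fun x => ‖fderiv ℝ u x‖)) p μ := by
          refine eLpNorm'_mono_ae (by linarith) ?_
          filter_upwards [ae_restrict_mem hA] with x hx
          have hux : DifferentiableAt ℝ u x :=
            (hu.differentiableOn one_ne_zero).differentiableAt (hopen.mem_nhds (hAne hx))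
          have hvx := (hχc.differentiable one_ne_zero x).hasFDerivAt.smul hux.hasFDerivAt
          rw [show fderiv ℝ v x = _ from hvx.fderiv]
          have hK1 : (0 : ℝ) ≤ K' := zero_le_one.trans (le_max_right _ _)
          simp only [Pi.smul_apply, Pi.add_apply, smul_eq_mul]
          rw [Real.norm_of_nonneg (by positivity)]
          refine (norm_add_le _ _).trans ?_
          rw [norm_smul, ContinuousLinearMap.norm_smulRight_apply, Real.norm_of_nonneg χ.nonneg]
          nlinarith [χ.le_one (x := x), norm_nonneg (u x), norm_nonneg (fderiv ℝ u x),
            (hK x).trans (le_max_left K 1), le_max_right K 1,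
            mul_le_mul_of_nonneg_right ((hK x).trans (le_max_left K 1)) (norm_nonneg (u x)),
            mul_le_mul_of_nonneg_right ((χ.le_one (x := x)).trans (le_max_right K 1))
              (norm_nonneg (fderiv ℝ u x))]
      _ ≤ ENNReal.ofReal K' * (eLpNorm' (fun x => ‖u x‖) p μ
            + eLpNorm' (fun x => ‖fderiv ℝ u x‖) p μ) := by
          rw [eLpNorm'_const_smul _ (by linarith), Real.enorm_eq_ofReal
            (zero_le_one.trans (le_max_right _ _))]
          gcongr
          exact eLpNorm'_add_le hum.norm hum'.norm hp.le
      _ = _ := by rw [eLpNorm'_norm, eLpNorm'_norm]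
  calc _ ≤ _ := hleft
    _ ≤ _ := hsob
    _ ≤ _ := by
      rw [mul_assoc]
      gcongr

open EuclideanGeometry in
/-- Inversion in the sphere of radius `√2` distorts integrals over the annulus by a bounded
factor. -/
theorem setLIntegral_inversion_le (g : EuclideanSpace ℝ (Fin d) → ℝ≥0∞) :
    ∫⁻ x in annulus d 1, g (inversion 0 (√2) x) ≤
      ENNReal.ofReal (2 ^ d) * ∫⁻ x in annulus d 1, g x := by
  have hs : (√2 : ℝ) ≠ 0 := by positivity
  have hA := measurableSet_annulus d 1
  have hmaps : ∀ x ∈ annulus d 1, inversion 0 (√2) x ∈ annulus d 1 := by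
    intro x hx
    have h := dist_inversion_center (0 : EuclideanSpace ℝ (Fin d)) x (√2)
    rw [dist_zero_right, dist_zero_right, Real.sq_sqrt zero_le_two] at h
    have h1 : 1 < ‖x‖ := hx.1
    have h2 : ‖x‖ < 2 * 1 := hx.2
    constructor
    · rw [h, lt_div_iff₀ (by linarith)]; linarith
    · rw [h, div_lt_iff₀ (by linarith)]; linarith
  have himg : inversion 0 (√2) '' annulus d 1 = annulus d 1 :=
    Set.Subset.antisymm (Set.image_subset_iff.2 hmaps) fun x hx =>
      ⟨_, hmaps x hx, inversion_inversion _ hs x⟩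
  have hcov := lintegral_image_eq_lintegral_abs_det_fderiv_mul volume hA
    (fun x hx => (hasFDerivAt_inversion (R := √2) (c := 0) (x := x) (by
      rintro rfl
      have h1 : 1 < ‖(0 : EuclideanSpace ℝ (Fin d))‖ := hx.1
      rw [norm_zero] at h1
      linarith)).hasFDerivWithinAt) ((inversion_injective _ hs).injOn)
    (fun x => g (inversion 0 (√2) x))
  rw [himg] at hcov
  rw [hcov, ← lintegral_const_mul' _ _ ENNReal.ofReal_ne_top]
  refine setLIntegral_mono' hA fun x hx => ?_
  simp only [inversion_inversion _ hs]
  gcongr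
  have h1 : 1 < ‖x‖ := hx.1
  rw [ContinuousLinearMap.det, ContinuousLinearMap.toLinearMap_smul, LinearMap.det_smul, abs_mul,
    finrank_euclideanSpace_fin]
  have hdet : |LinearMap.det (((ℝ ∙ (x - 0))ᗮ.reflection :
      EuclideanSpace ℝ (Fin d) →L[ℝ] EuclideanSpace ℝ (Fin d)) :
      EuclideanSpace ℝ (Fin d) →ₗ[ℝ] EuclideanSpace ℝ (Fin d))| = 1 := by
    rw [← LinearMap.normDet_eq_abs_det]
    exact ((ℝ ∙ (x - 0))ᗮ.reflection).toLinearIsometry.normDet_eq_one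
  rw [hdet, mul_one, dist_zero_right, div_pow, Real.sq_sqrt zero_le_two,
    abs_of_nonneg (by positivity)]
  gcongr
  rw [div_le_iff₀ (by positivity)]
  nlinarith

open EuclideanGeometry in
theorem eLpNorm'_comp_inversion_le {F : Type*} [NormedAddCommGroup F] {p : ℝ} (hp : 0 < p)
    (w : EuclideanSpace ℝ (Fin d) → F) :
    eLpNorm' (fun x => w (inversion 0 (√2) x)) p (volume.restrict (annulus d 1)) ≤
      ENNReal.ofReal (2 ^ d) ^ (1 / p) * eLpNorm' w p (volume.restrict (annulus d 1)) := by
  unfold eLpNorm'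
  rw [← ENNReal.mul_rpow_of_nonneg _ _ (by positivity)]
  exact ENNReal.rpow_le_rpow (setLIntegral_inversion_le fun x => ‖w x‖ₑ ^ p) (by positivity)

open EuclideanGeometry in
/-- The first-order Sobolev inequality on the annulus. -/
theorem exists_eLpNorm'_le_add_fderiv {p q : ℝ} (hp : 1 < p) (hpd : p < d)
    (hq : 1 / q = 1 / p - 1 / d) :
    ∃ C : ℝ≥0∞, C ≠ ∞ ∧ ∀ (F : Type) [NormedAddCommGroup F] [NormedSpace ℝ F]
      (f : EuclideanSpace ℝ (Fin d) → F), ContDiff ℝ 1 f →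
      eLpNorm' f q (volume.restrict (annulus d 1)) ≤
        C * (eLpNorm' f p (volume.restrict (annulus d 1)) +
          eLpNorm' (fderiv ℝ f) p (volume.restrict (annulus d 1))) := by
  obtain ⟨C, hC, H⟩ := exists_eLpNorm'_inner_le hp hpd hq
  have hp0 : 0 < p := by linarith
  have hq0 : 0 < 1 / q := by
    rw [hq, sub_pos]; exact one_div_lt_one_div_of_lt (by linarith) hpd
  have hq0' : 0 < q := by simpa using hq0
  have hq1 : 1 / q ≤ 1 := by
    have h1 : 1 / p < 1 := by rw [div_lt_one hp0]; exact hp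
    have h2 : (0 : ℝ) ≤ 1 / d := by positivity
    linarith
  set K : ℝ≥0∞ := ENNReal.ofReal (2 ^ d) with hK
  have hKp : K ^ (1 / p) ≠ ∞ := ENNReal.rpow_ne_top_of_nonneg (by positivity) ENNReal.ofReal_ne_top
  have hKq : K ^ (1 / q) ≠ ∞ := ENNReal.rpow_ne_top_of_nonneg hq0.le ENNReal.ofReal_ne_top
  refine ⟨C + K ^ (1 / q) * (C * (2 * K ^ (1 / p))), by finiteness, fun F _ _ f hf => ?_⟩
  have hA := measurableSet_annulus d 1
  set μ := volume.restrict (annulus d 1) with hμ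
  set ι : EuclideanSpace ℝ (Fin d) → EuclideanSpace ℝ (Fin d) := inversion 0 (√2) with hι
  have hιι : ∀ x, ι (ι x) = x := inversion_inversion _ (by positivity)
  have hιc : ContDiffOn ℝ 1 ι {0}ᶜ :=
    ContDiffOn.inversion (n := 1) contDiffOn_const contDiffOn_const contDiffOn_id fun a ha => ha
  set u : EuclideanSpace ℝ (Fin d) → F := fun x => f (ι x) with hu
  have huc : ContDiffOn ℝ 1 u {0}ᶜ := hf.comp_contDiffOn hιc
  have hdu : ∀ x ∈ annulus d 1, ‖fderiv ℝ u x‖ ≤ ‖(2 : ℝ) • ‖fderiv ℝ f (ι x)‖‖ := by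
    intro x hx
    have h1 : 1 < ‖x‖ := hx.1
    have hx0 : x ≠ 0 := norm_pos_iff.1 (by linarith)
    have h := (hf.differentiable one_ne_zero (ι x)).hasFDerivAt.comp x
      (hasFDerivAt_inversion (R := √2) hx0)
    rw [show fderiv ℝ u x = _ from h.fderiv]
    refine (ContinuousLinearMap.opNorm_comp_le _ _).trans ?_
    rw [norm_smul 2, norm_norm, mul_comm, Real.norm_of_nonneg zero_le_two]
    gcongr
    rw [norm_smul, div_pow, Real.sq_sqrt zero_le_two, dist_zero_right,
      Real.norm_of_nonneg (by positivity)]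
    have hrefl : ‖((ℝ ∙ (x - 0))ᗮ.reflection :
        EuclideanSpace ℝ (Fin d) →L[ℝ] EuclideanSpace ℝ (Fin d))‖ ≤ 1 :=
      ContinuousLinearMap.opNorm_le_bound _ zero_le_one fun y => by simp
    have h2 : 2 / ‖x‖ ^ 2 ≤ 2 := by rw [div_le_iff₀ (by positivity)]; nlinarith
    calc _ ≤ (2 : ℝ) * 1 := mul_le_mul h2 hrefl (norm_nonneg _) zero_le_two
      _ = 2 := mul_one 2
  have hup : eLpNorm' u p μ ≤ K ^ (1 / p) * eLpNorm' f p μ := eLpNorm'_comp_inversion_le hp0 f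
  have hdup : eLpNorm' (fderiv ℝ u) p μ ≤ 2 * K ^ (1 / p) * eLpNorm' (fderiv ℝ f) p μ := by
    calc eLpNorm' (fderiv ℝ u) p μ
        ≤ eLpNorm' ((2 : ℝ) • fun x => ‖fderiv ℝ f (ι x)‖) p μ :=
          eLpNorm'_mono_ae hp0.le (by filter_upwards [ae_restrict_mem hA] with x hx using hdu x hx)
      _ = 2 * eLpNorm' (fun x => fderiv ℝ f (ι x)) p μ := by
          rw [eLpNorm'_const_smul _ hp0, eLpNorm'_norm, Real.enorm_eq_ofReal zero_le_two]
          simp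
      _ ≤ _ := by
          rw [mul_assoc]
          gcongr
          exact eLpNorm'_comp_inversion_le hp0 _
  set B : Set (EuclideanSpace ℝ (Fin d)) := Metric.closedBall 0 (3 / 2) with hB
  have hBm : MeasurableSet B := measurableSet_closedBall
  have hsplit : ∫⁻ x, ‖f x‖ₑ ^ q ∂μ ≤
      (∫⁻ x in annulus d 1 ∩ B, ‖f x‖ₑ ^ q) + K * ∫⁻ x in annulus d 1 ∩ B, ‖u x‖ₑ ^ q := by
    calc ∫⁻ x, ‖f x‖ₑ ^ q ∂μ
        ≤ ∫⁻ x, B.indicator (fun x => ‖f x‖ₑ ^ q) x +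
            B.indicator (fun x => ‖u x‖ₑ ^ q) (ι x) ∂μ := by
          refine setLIntegral_mono' hA fun x hx => ?_
          by_cases hxB : x ∈ B
          · rw [Set.indicator_of_mem hxB]
            exact le_self_add
          · have hxn : 3 / 2 < ‖x‖ := by simpa [hB] using hxB
            have hιB : ι x ∈ B := by
              rw [hB, Metric.mem_closedBall, hι, dist_inversion_center, dist_zero_right,
                Real.sq_sqrt zero_le_two, div_le_iff₀ (by linarith)]
              linarith
            rw [Set.indicator_of_mem hιB]
            simp only [hu, hιι]
            exact le_add_self
      _ = (∫⁻ x, B.indicator (fun x => ‖f x‖ₑ ^ q) x ∂μ) +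
            ∫⁻ x, B.indicator (fun x => ‖u x‖ₑ ^ q) (ι x) ∂μ :=
          lintegral_add_left ((hf.continuous.enorm.measurable.pow_const q).indicator hBm) _
      _ ≤ (∫⁻ x, B.indicator (fun x => ‖f x‖ₑ ^ q) x ∂μ) +
            K * ∫⁻ x, B.indicator (fun x => ‖u x‖ₑ ^ q) x ∂μ := by
          gcongr
          exact setLIntegral_inversion_le _
      _ = _ := by
          rw [lintegral_indicator hBm, lintegral_indicator hBm, hμ,
            Measure.restrict_restrict hBm, Set.inter_comm]
  have hHf := H F f hf.contDiffOn
  have hHu := H F u huc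
  calc eLpNorm' f q μ
      ≤ eLpNorm' f q (volume.restrict (annulus d 1 ∩ B)) +
          K ^ (1 / q) * eLpNorm' u q (volume.restrict (annulus d 1 ∩ B)) := by
        unfold eLpNorm'
        rw [← ENNReal.mul_rpow_of_nonneg _ _ hq0.le]
        exact (ENNReal.rpow_le_rpow hsplit hq0.le).trans
          (ENNReal.rpow_add_le_add_rpow _ _ hq0.le hq1)
    _ ≤ C * (eLpNorm' f p μ + eLpNorm' (fderiv ℝ f) p μ) +
          K ^ (1 / q) * (C * (2 * K ^ (1 / p) * eLpNorm' f p μ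
            + 2 * K ^ (1 / p) * eLpNorm' (fderiv ℝ f) p μ)) := by
        gcongr
        refine hHu.trans ?_
        gcongr
        refine hup.trans ?_
        gcongr
        exact le_mul_of_one_le_left' one_le_two
    _ = _ := by ring

/-- The Sobolev inequality of order `m` on the annulus, at the critical exponent. -/
theorem exists_eLpNorm'_le_sum_iteratedFDeriv (hd : 1 ≤ d) (m : ℕ) {p q : ℝ} (hp : 1 < p)
    (hmp : (m : ℝ) / d < 1 / p) (hq : 1 / q = 1 / p - m / d) :
    ∃ C : ℝ≥0∞, C ≠ ∞ ∧ ∀ (F : Type) [NormedAddCommGroup F] [NormedSpace ℝ F]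
      (f : EuclideanSpace ℝ (Fin d) → F), ContDiff ℝ m f →
      eLpNorm' f q (volume.restrict (annulus d 1)) ≤
        C * ∑ j ∈ Finset.range (m + 1),
          eLpNorm' (iteratedFDeriv ℝ j f) p (volume.restrict (annulus d 1)) := by
  have hp0 : 0 < p := by linarith
  induction m generalizing q with
  | zero =>
    have hqp : q = p := by simpa using hq
    subst hqp
    refine ⟨1, ENNReal.one_ne_top, fun F _ _ f _ => ?_⟩
    rw [one_mul, Finset.sum_range_one]
    exact (eLpNorm'_congr_norm_ae (ae_of_all _ fun x => (norm_iteratedFDeriv_zero).symm)).le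
  | succ m ih =>
    have hd0 : (0 : ℝ) < d := by exact_mod_cast hd
    push_cast at hmp hq
    rw [add_div] at hmp hq
    have hd1 : 0 < 1 / (d : ℝ) := by positivity
    have hmd : 0 ≤ (m : ℝ) / d := by positivity
    obtain ⟨s, hs⟩ : ∃ s : ℝ, 1 / s = 1 / p - m / d := ⟨1 / (1 / p - m / d), one_div_one_div _⟩
    have hs0 : 0 < s := one_div_pos.1 (by rw [hs]; linarith)
    have hs1 : 1 < s := by
      have h1 : 1 / p < 1 := by rw [div_lt_one hp0]; exact hp
      have : 1 / s < 1 := by rw [hs]; linarith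
      rwa [div_lt_one hs0] at this
    have hsd : s < d := by
      refine lt_of_one_div_lt_one_div hd0 ?_
      rw [hs]; linarith
    obtain ⟨C₁, hC₁, H₁⟩ := exists_eLpNorm'_le_add_fderiv (d := d) (q := q) hs1 hsd
      (by rw [hq, hs]; ring)
    obtain ⟨C₂, hC₂, H₂⟩ := ih (q := s) (by linarith) hs
    refine ⟨C₁ * (C₂ + C₂), by finiteness, fun F _ _ f hf => ?_⟩
    set μ := volume.restrict (annulus d 1)
    have hf1 : ContDiff ℝ 1 f := hf.of_le (by exact_mod_cast Nat.le_add_left 1 m)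
    have hfm : ContDiff ℝ m f := hf.of_le (by exact_mod_cast Nat.le_succ m)
    have hf' : ContDiff ℝ m (fderiv ℝ f) := hf.fderiv_right (by norm_cast)
    have hsum₁ : ∑ j ∈ Finset.range (m + 1), eLpNorm' (iteratedFDeriv ℝ j f) p μ
        ≤ ∑ j ∈ Finset.range (m + 1 + 1), eLpNorm' (iteratedFDeriv ℝ j f) p μ :=
      Finset.sum_le_sum_of_subset (Finset.range_mono (Nat.le_succ _))
    have hsum₂ : ∑ j ∈ Finset.range (m + 1), eLpNorm' (iteratedFDeriv ℝ j (fderiv ℝ f)) p μ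
        ≤ ∑ j ∈ Finset.range (m + 1 + 1), eLpNorm' (iteratedFDeriv ℝ j f) p μ := by
      rw [Finset.sum_range_succ' _ (m + 1)]
      refine le_add_of_le_of_nonneg (Finset.sum_le_sum fun j _ => ?_) zero_le
      exact (eLpNorm'_congr_norm_ae (ae_of_all _ fun x => norm_iteratedFDeriv_fderiv)).le
    calc eLpNorm' f q μ ≤ C₁ * (eLpNorm' f s μ + eLpNorm' (fderiv ℝ f) s μ) := H₁ F f hf1
      _ ≤ C₁ * (C₂ * ∑ j ∈ Finset.range (m + 1 + 1), eLpNorm' (iteratedFDeriv ℝ j f) p μ +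
            C₂ * ∑ j ∈ Finset.range (m + 1 + 1), eLpNorm' (iteratedFDeriv ℝ j f) p μ) := by
          gcongr
          · exact (H₂ F f hfm).trans (by gcongr)
          · exact (H₂ _ (fderiv ℝ f) hf').trans (by gcongr)
      _ = _ := by ring

/-- The Sobolev inequality of order `m` on the annulus, for all admissible exponents. -/
theorem exists_eLpNorm'_le_sum_iteratedFDeriv_of_le (hd : 1 ≤ d) (m : ℕ) {p q : ℝ} (hp : 1 < p)
    (hq : 0 < q) (h : (m : ℝ) / d < 1 / p ∧ 1 / p - m / d ≤ 1 / q ∨ (m : ℝ) / d = 1 / p) :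
    ∃ C : ℝ≥0∞, C ≠ ∞ ∧ ∀ f : EuclideanSpace ℝ (Fin d) → ℝ, ContDiff ℝ m f →
      eLpNorm' f q (volume.restrict (annulus d 1)) ≤
        C * ∑ j ∈ Finset.range (m + 1),
          eLpNorm' (iteratedFDeriv ℝ j f) p (volume.restrict (annulus d 1)) := by
  have hp0 : 0 < p := by linarith
  have hp1 : 1 / p < 1 := by rw [div_lt_one hp0]; exact hp
  obtain ⟨r, hr, hrp, hrm, hrq⟩ : ∃ r : ℝ, 1 < r ∧ r ≤ p ∧ (m : ℝ) / d < 1 / r ∧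
      1 / r - m / d ≤ 1 / q := by
    rcases h with ⟨h1, h2⟩ | h
    · exact ⟨p, hp, le_rfl, h1, h2⟩
    · have hq' : 0 < 1 / q := by positivity
      set ε : ℝ := min (1 / q) ((1 - 1 / p) / 2) with hε
      have hε0 : 0 < ε := lt_min hq' (by linarith)
      have hε1 : ε ≤ 1 / q := min_le_left _ _
      have hε2 : ε ≤ (1 - 1 / p) / 2 := min_le_right _ _
      have hpos : 0 < 1 / p := by positivity
      refine ⟨1 / (1 / p + ε), ?_, ?_, ?_, ?_⟩
      · rw [lt_div_iff₀ (by linarith)]; linarith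
      · rw [div_le_iff₀ (by linarith)]
        have : p * (1 / p) = 1 := mul_one_div_cancel hp0.ne'
        nlinarith
      · rw [one_div_one_div]; linarith
      · rw [one_div_one_div]; linarith
  obtain ⟨s, hs⟩ : ∃ s : ℝ, 1 / s = 1 / r - m / d := ⟨1 / (1 / r - m / d), one_div_one_div _⟩
  have hs0 : 0 < s := one_div_pos.1 (by rw [hs]; linarith)
  have hqs : q ≤ s := (one_div_le_one_div hs0 hq).1 (by rw [hs]; exact hrq)
  obtain ⟨C, hC, H⟩ := exists_eLpNorm'_le_sum_iteratedFDeriv hd m hr hrm hs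
  set μ := (volume : Measure (EuclideanSpace ℝ (Fin d))).restrict (annulus d 1) with hμ
  have hexp : ∀ {a b : ℝ}, 0 < a → a ≤ b → μ Set.univ ^ (1 / a - 1 / b) ≠ ∞ := fun ha hab =>
    ENNReal.rpow_ne_top_of_nonneg (sub_nonneg.2 (one_div_le_one_div_of_le ha hab))
      (measure_ne_top _ _)
  have hV₁ := hexp hq hqs
  have hV₂ := hexp (by linarith) hrp
  refine ⟨C * μ Set.univ ^ (1 / r - 1 / p) * μ Set.univ ^ (1 / q - 1 / s), by finiteness,
    fun f hf => ?_⟩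
  calc eLpNorm' f q μ ≤ eLpNorm' f s μ * μ Set.univ ^ (1 / q - 1 / s) :=
        eLpNorm'_le_eLpNorm'_mul_rpow_measure_univ hq hqs hf.continuous.aestronglyMeasurable
    _ ≤ (C * ∑ j ∈ Finset.range (m + 1), eLpNorm' (iteratedFDeriv ℝ j f) p μ *
          μ Set.univ ^ (1 / r - 1 / p)) * μ Set.univ ^ (1 / q - 1 / s) := by
        gcongr
        refine (H ℝ f hf).trans ?_
        gcongr with j hj
        refine eLpNorm'_le_eLpNorm'_mul_rpow_measure_univ (by linarith) hrp ?_
        exact (hf.continuous_iteratedFDeriv (by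
          exact_mod_cast Nat.lt_succ_iff.1 (Finset.mem_range.1 hj))).aestronglyMeasurable
    _ = _ := by
        rw [← Finset.sum_mul]
        ring

open scoped Pointwise in
theorem smul_annulus {R : ℝ} (hR : 0 < R) : R • annulus d 1 = annulus d R := by
  ext x
  rw [Set.mem_smul_set_iff_inv_smul_mem₀ hR.ne']
  simp only [annulus, Set.mem_ofPred_eq, norm_smul, norm_inv, Real.norm_of_nonneg hR.le]
  rw [lt_inv_mul_iff₀ hR, inv_mul_lt_iff₀ hR]
  constructor <;> rintro ⟨h1, h2⟩ <;> constructor <;> linarith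

open scoped Pointwise in
/-- The weighted `L^p` norm of the `j`-th derivative over the annulus scales like `R ^ δ`. -/
theorem weighted_norm_annulus_eq {F : Type*} [NormedAddCommGroup F] [NormedSpace ℝ F]
    {f : EuclideanSpace ℝ (Fin d) → F} {j : ℕ} (hf : ContDiff ℝ j f) {p δ R : ℝ} (hp : 0 < p)
    (hR : 0 < R) :
    (∫ x in annulus d R, (‖x‖ ^ (δ - (d : ℝ) / p + j) * ‖iteratedFDeriv ℝ j f x‖) ^ p) ^ (1 / p) =
      R ^ δ * (∫ x in annulus d 1, (‖x‖ ^ (δ - (d : ℝ) / p + j) *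
        ‖iteratedFDeriv ℝ j (fun y => f (R • y)) x‖) ^ p) ^ (1 / p) := by
  have h := Measure.setIntegral_comp_smul volume (fun x : EuclideanSpace ℝ (Fin d) =>
    (‖x‖ ^ (δ - (d : ℝ) / p + j) * ‖iteratedFDeriv ℝ j f x‖) ^ p) (annulus d 1) hR.ne'
  rw [smul_annulus hR, finrank_euclideanSpace_fin, abs_of_pos (by positivity), smul_eq_mul,
    eq_inv_mul_iff_mul_eq₀ (by positivity)] at h
  have hpt : ∀ x : EuclideanSpace ℝ (Fin d),
      (‖R • x‖ ^ (δ - (d : ℝ) / p + j) * ‖iteratedFDeriv ℝ j f (R • x)‖) ^ p =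
      R ^ ((δ - (d : ℝ) / p) * p) * (‖x‖ ^ (δ - (d : ℝ) / p + j) *
        ‖iteratedFDeriv ℝ j (fun y => f (R • y)) x‖) ^ p := by
    intro x
    rw [iteratedFDeriv_comp_const_smul R hf, norm_smul, norm_smul, Real.norm_of_nonneg hR.le,
      Real.norm_of_nonneg (by positivity), Real.mul_rpow hR.le (norm_nonneg _),
      Real.rpow_add hR, Real.rpow_natCast, Real.rpow_mul hR.le,
      ← Real.mul_rpow (by positivity) (by positivity)]
    ring_nf
  simp only [hpt] at h
  rw [integral_const_mul] at h
  have hnn : 0 ≤ ∫ x in annulus d 1, (‖x‖ ^ (δ - (d : ℝ) / p + j) *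
      ‖iteratedFDeriv ℝ j (fun y => f (R • y)) x‖) ^ p :=
    integral_nonneg fun x => by positivity
  rw [← h, ← mul_assoc, ← Real.rpow_natCast, ← Real.rpow_add hR,
    Real.mul_rpow (by positivity) hnn, ← Real.rpow_mul hR.le]
  congr 2
  field_simp
  ring

theorem ofReal_weighted_norm_eq {F : Type*} [NormedAddCommGroup F]
    {w : EuclideanSpace ℝ (Fin d) → F} (hw : Continuous w) {p : ℝ} (hp : 0 < p) (b : ℝ) :
    ENNReal.ofReal ((∫ x in annulus d 1, (‖x‖ ^ b * ‖w x‖) ^ p) ^ (1 / p)) =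
      eLpNorm' (fun x => ‖x‖ ^ b * ‖w x‖) p (volume.restrict (annulus d 1)) := by
  have hint : IntegrableOn (fun x => (‖x‖ ^ b * ‖w x‖) ^ p) (annulus d 1) := by
    have hcpt : IsCompact (Metric.closedBall (0 : EuclideanSpace ℝ (Fin d)) 2 ∩ {x | 1 ≤ ‖x‖}) :=
      (isCompact_closedBall _ _).inter_right (isClosed_le continuous_const continuous_norm)
    refine (ContinuousOn.integrableOn_compact hcpt ?_).mono_set fun x hx =>
      ⟨by simpa using hx.2.le, hx.1.le⟩
    refine ContinuousOn.rpow_const (ContinuousOn.mul ?_ hw.norm.continuousOn) fun _ _ =>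
      Or.inr hp.le
    refine continuous_norm.continuousOn.rpow_const fun x hx => Or.inl ?_
    have h1 : 1 ≤ ‖x‖ := hx.2
    linarith
  rw [← ENNReal.ofReal_rpow_of_nonneg (integral_nonneg fun x => by positivity) (by positivity),
    ofReal_integral_eq_lintegral_ofReal hint (ae_of_all _ fun x => by positivity), eLpNorm']
  congr 2 with x
  rw [Real.enorm_eq_ofReal (by positivity), ENNReal.ofReal_rpow_of_nonneg (by positivity) hp.le]

theorem rpow_le_two_rpow_abs {s : ℝ} (h1 : 1 ≤ s) (h2 : s ≤ 2) (b : ℝ) : s ^ b ≤ 2 ^ |b| :=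
  (Real.rpow_le_rpow_of_exponent_le h1 (le_abs_self b)).trans
    (Real.rpow_le_rpow (by linarith) h2 (abs_nonneg b))

theorem ofReal_weighted_norm_le {F : Type*} [NormedAddCommGroup F]
    {w : EuclideanSpace ℝ (Fin d) → F} (hw : Continuous w) {p : ℝ} (hp : 0 < p) (b : ℝ) :
    ENNReal.ofReal ((∫ x in annulus d 1, (‖x‖ ^ b * ‖w x‖) ^ p) ^ (1 / p)) ≤
      ENNReal.ofReal (2 ^ |b|) * eLpNorm' w p (volume.restrict (annulus d 1)) := by
  rw [ofReal_weighted_norm_eq hw hp, ← eLpNorm'_norm (f := w),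
    ← Real.enorm_eq_ofReal (by positivity), ← eLpNorm'_const_smul _ hp]
  refine eLpNorm'_mono_ae hp.le ?_
  filter_upwards [ae_restrict_mem (measurableSet_annulus d 1)] with x hx
  simp only [Pi.smul_apply, smul_eq_mul]
  rw [Real.norm_of_nonneg (by positivity), Real.norm_of_nonneg (by positivity)]
  gcongr
  exact rpow_le_two_rpow_abs hx.1.le (by simpa using hx.2.le) b

theorem eLpNorm'_le_ofReal_weighted_norm {F : Type*} [NormedAddCommGroup F]
    {w : EuclideanSpace ℝ (Fin d) → F} (hw : Continuous w) {p : ℝ} (hp : 0 < p) (b : ℝ) :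
    eLpNorm' w p (volume.restrict (annulus d 1)) ≤ ENNReal.ofReal (2 ^ |b|) *
      ENNReal.ofReal ((∫ x in annulus d 1, (‖x‖ ^ b * ‖w x‖) ^ p) ^ (1 / p)) := by
  rw [ofReal_weighted_norm_eq hw hp, ← Real.enorm_eq_ofReal (by positivity),
    ← eLpNorm'_const_smul _ hp]
  refine eLpNorm'_mono_ae hp.le ?_
  filter_upwards [ae_restrict_mem (measurableSet_annulus d 1)] with x hx
  have h1 : 1 < ‖x‖ := hx.1
  simp only [Pi.smul_apply, smul_eq_mul]
  rw [Real.norm_of_nonneg (by positivity), ← mul_assoc]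
  refine le_mul_of_one_le_left (norm_nonneg _) ?_
  calc (1 : ℝ) = ‖x‖ ^ (-b) * ‖x‖ ^ b := by
        rw [← Real.rpow_add (by linarith), neg_add_cancel, Real.rpow_zero]
    _ ≤ 2 ^ |b| * ‖x‖ ^ b := by
        gcongr
        simpa using rpow_le_two_rpow_abs hx.1.le (by simpa using hx.2.le) (-b)

/-- The weighted Sobolev inequality on the unit annulus. -/
theorem exists_weighted_norm_le_sum (hd : 1 ≤ d) (m : ℕ) {p q δ : ℝ} (hp : 1 < p) (hq : 0 < q)
    (h : (m : ℝ) / d < 1 / p ∧ 1 / p - m / d ≤ 1 / q ∨ (m : ℝ) / d = 1 / p) :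
    ∃ C : ℝ, 0 < C ∧ ∀ f : EuclideanSpace ℝ (Fin d) → ℝ, ContDiff ℝ m f →
      (∫ x in annulus d 1, (‖x‖ ^ (δ - (d : ℝ) / q) * ‖f x‖) ^ q) ^ (1 / q) ≤
        C * ∑ j ∈ Finset.range (m + 1), (∫ x in annulus d 1,
          (‖x‖ ^ (δ - (d : ℝ) / p + j) * ‖iteratedFDeriv ℝ j f x‖) ^ p) ^ (1 / p) := by
  have hp0 : 0 < p := by linarith
  obtain ⟨C, hC, H⟩ := exists_eLpNorm'_le_sum_iteratedFDeriv_of_le hd m hp hq h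
  set L : ℝ := ∑ j ∈ Finset.range (m + 1), 2 ^ |δ - (d : ℝ) / p + j| with hL
  set C' : ℝ≥0∞ := ENNReal.ofReal (2 ^ |δ - (d : ℝ) / q|) * (C * ENNReal.ofReal L) with hC'
  have hC'top : C' ≠ ∞ := by finiteness
  refine ⟨C'.toReal + 1, by positivity, fun f hf => ?_⟩
  set I : ℕ → ℝ := fun j => (∫ x in annulus d 1,
    (‖x‖ ^ (δ - (d : ℝ) / p + j) * ‖iteratedFDeriv ℝ j f x‖) ^ p) ^ (1 / p) with hI
  have hI0 : ∀ j, 0 ≤ I j := fun j =>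
    Real.rpow_nonneg (integral_nonneg fun x => by positivity) _
  have hsum : 0 ≤ ∑ j ∈ Finset.range (m + 1), I j := Finset.sum_nonneg fun j _ => hI0 j
  refine le_trans ?_ (mul_le_mul_of_nonneg_right (le_add_of_nonneg_right zero_le_one) hsum)
  rw [← ENNReal.ofReal_le_ofReal_iff (by positivity), ENNReal.ofReal_mul (by positivity),
    ENNReal.ofReal_toReal hC'top]
  refine (ofReal_weighted_norm_le hf.continuous hq _).trans ?_
  rw [hC', mul_assoc, mul_assoc]
  gcongr
  refine (H f hf).trans ?_
  gcongr
  rw [ENNReal.ofReal_sum_of_nonneg fun j _ => hI0 j, Finset.mul_sum]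
  refine Finset.sum_le_sum fun j hj => ?_
  refine (eLpNorm'_le_ofReal_weighted_norm (hf.continuous_iteratedFDeriv (by
    exact_mod_cast Nat.lt_succ_iff.1 (Finset.mem_range.1 hj))) hp0
    (δ - (d : ℝ) / p + j)).trans ?_
  gcongr
  exact Finset.single_le_sum (f := fun j : ℕ => (2 : ℝ) ^ |δ - (d : ℝ) / p + j|)
    (fun _ _ => by positivity) hj

end Annulus

/-- Scale-invariant Sobolev inequality on the annuli
`A_R = {R < |x| < 2R}`: under the usual exponent conditions,
`‖ |x|^{δ-d/q} f ‖_{L^q(A_R)} ≤ C Σ_{j≤m} ‖ |x|^{δ-d/p+j} ∇^j f ‖_{L^p(A_R)}`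
with `C` independent of `R > 0`. -/
theorem annulus_sobolev_inequality
    (d m : ℕ) (hd : 1 ≤ d) (p q δ : ℝ) (hp : 1 < p)
    (hcase : ((m : ℝ) * p < d ∧ p ≤ q ∧ q ≤ d * p / (d - m * p)) ∨
             ((m : ℝ) * p = d ∧ p ≤ q)) :
    ∃ C : ℝ, 0 < C ∧ ∀ R : ℝ, 0 < R →
      ∀ f : EuclideanSpace ℝ (Fin d) → ℝ, ContDiff ℝ m f →
      (∫ x in {x : EuclideanSpace ℝ (Fin d) | R < ‖x‖ ∧ ‖x‖ < 2 * R},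
          (‖x‖ ^ (δ - (d : ℝ) / q) * |f x|) ^ q) ^ (1 / q) ≤
        C * ∑ j ∈ Finset.range (m + 1),
          (∫ x in {x : EuclideanSpace ℝ (Fin d) | R < ‖x‖ ∧ ‖x‖ < 2 * R},
            (‖x‖ ^ (δ - (d : ℝ) / p + (j : ℝ)) * ‖iteratedFDeriv ℝ j f x‖) ^ p) ^ (1 / p) := by
  have hp0 : 0 < p := by linarith
  have hd0 : (0 : ℝ) < d := by exact_mod_cast hd
  have hq : 0 < q := by rcases hcase with h | h <;> linarith [h.2]
  have hexp : (m : ℝ) / d < 1 / p ∧ 1 / p - m / d ≤ 1 / q ∨ (m : ℝ) / d = 1 / p := by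
    rcases hcase with ⟨h1, -, h2⟩ | ⟨h1, -⟩
    · refine Or.inl ⟨by rwa [div_lt_div_iff₀ hd0 hp0, one_mul], ?_⟩
      calc 1 / p - m / d = 1 / (d * p / (d - m * p)) := by
            field_simp
        _ ≤ 1 / q := one_div_le_one_div_of_le hq h2
    · exact Or.inr (by rw [div_eq_div_iff hd0.ne' hp0.ne', one_mul, h1])
  obtain ⟨C, hC, H⟩ := exists_weighted_norm_le_sum (δ := δ) hd m hp hq hexp
  refine ⟨C, hC, fun R hR f hf => ?_⟩
  have hg : ContDiff ℝ m fun y => f (R • y) := hf.comp (contDiff_const_smul R)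
  have hright : ∀ j ∈ Finset.range (m + 1), _ := fun j hj =>
    weighted_norm_annulus_eq (j := j) (δ := δ) (hf.of_le (by
      exact_mod_cast Nat.lt_succ_iff.1 (Finset.mem_range.1 hj))) hp0 hR
  have hleft := weighted_norm_annulus_eq (j := 0) (δ := δ) (hf.of_le (by simp)) hq hR
  simp only [norm_iteratedFDeriv_zero, CharP.cast_eq_zero, add_zero, Real.norm_eq_abs] at hleft
  refine hleft.trans_le ((mul_le_mul_of_nonneg_left (H _ hg) (by positivity)).trans_eq ?_)
  rw [mul_left_comm, Finset.mul_sum]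
  exact congrArg (C * ·) (Finset.sum_congr rfl fun j hj => (hright j hj).symm)
end
end
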